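/- arXiv:2510.03835 — 3 statements merged into one kernel-verified Lean document; each statement's English description precedes it below -/
import Mathlib

section
/- Let 0 < s < 1, let max{−3, −3/2 − 2s} < γ < −2s, and let ℓ ≤ 0. Then there exists a constant C = C(s, γ, ℓ) > 0 such that for every f ∈ C_c^∞(ℝ³; ℝ), ‖⟨v⟩^{ℓ + γ/(2s)} ∇_v f‖_{L²(ℝ³)} ≤ C · [⟨v⟩^{ℓ + γ/2} f]_{Ḣ^s}^{s} · [⟨v⟩^{ℓ + (1+s)γ/(2s)} ∇_v f]_{Ḣ^s}^{1−s}. (This is the velocity-weighted Gagliardo–Nirenberg interpolation inequality, in the gradient form in which it is applied in the paper: a weighted L² norm of the gradient is controlled by an interpolation between a weighted fractional Sobolev seminorm of f and one of ∇_v f, with the weights ⟨v⟩^{ℓ+γ/2} and ⟨v⟩^{ℓ+(1+s)γ/(2s)} matching so that the weight exponents satisfy ℓ+γ/(2s) = s(ℓ+γ/2) + (1−s)(ℓ+(1+s)γ/(2s)).) -/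
open MeasureTheory Real

noncomputable section

/-- ℝ³ as a Euclidean space. -/
abbrev E3 := EuclideanSpace ℝ (Fin 3)

/-- Japanese bracket `⟨v⟩ = √(1 + |v|²)`. -/
def jap (v : E3) : ℝ := Real.sqrt (1 + ‖v‖ ^ 2)

/-- The `j`-th partial derivative of `f : ℝ³ → ℝ`. -/
def pd (f : E3 → ℝ) (j : Fin 3) (v : E3) : ℝ :=
  fderiv ℝ f v (EuclideanSpace.single j 1)

/-- Square of the homogeneous Gagliardo fractional Sobolev seminorm `[g]_{Ḣ^s}²`. -/
def gagSq (s : ℝ) (g : E3 → ℝ) : ℝ :=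
  ∫ v : E3, ∫ w : E3, (g v - g w) ^ 2 / ‖v - w‖ ^ (3 + 2 * s)

open scoped ENNReal

/-- The nonnegative Gagliardo integrand. -/
def gk (s : ℝ) (g : E3 → ℝ) (v w : E3) : ℝ≥0∞ :=
  ENNReal.ofReal ((g v - g w) ^ 2 / ‖v - w‖ ^ (3 + 2 * s))

/-- The Gagliardo energy as an extended nonnegative number. -/
def gagE (s : ℝ) (g : E3 → ℝ) : ℝ≥0∞ := ∫⁻ v, ∫⁻ w, gk s g v w

lemma gk_meas (s : ℝ) {g : E3 → ℝ} (hg : Continuous g) :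
    Measurable (fun p : E3 × E3 => gk s g p.1 p.2) := by
  have := hg.measurable
  unfold gk
  fun_prop

lemma gk_meas' (s : ℝ) {g : E3 → ℝ} (hg : Continuous g) (v : E3) :
    Measurable (fun w : E3 => gk s g v w) := by
  have := hg.measurable
  unfold gk
  fun_prop

lemma finrank_E3 : Module.finrank ℝ E3 = 3 := by simp

lemma lint_smul (f : E3 → ℝ≥0∞) {r : ℝ} (hr : 0 < r) :
    ∫⁻ z, f (r • z) = ENNReal.ofReal (r ^ (-3 : ℝ)) * ∫⁻ z, f z := by
  have h1 := Measure.map_addHaar_smul (volume : Measure E3) hr.ne'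
  have e : MeasurableEmbedding (fun z : E3 => r • z) :=
    (Homeomorph.smulOfNeZero r hr.ne').measurableEmbedding
  have h2 := e.lintegral_map (μ := volume) f
  rw [← h2, h1, lintegral_smul_measure, finrank_E3, smul_eq_mul]
  congr 2
  rw [abs_of_pos (by positivity), rpow_neg hr.le]
  norm_cast

lemma kernel_near_fin {s : ℝ} (hs1 : s < 1) :
    ∫⁻ z in Metric.ball (0 : E3) 1, ENNReal.ofReal (‖z‖ ^ (-1 - 2 * s)) < ∞ := by
  have h : IntegrableOn (fun z : E3 => ‖z‖ ^ (-1 - 2 * s)) (Metric.ball (0 : E3) 1) := by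
    rw [integrableOn_fun_norm_addHaar volume (f := fun y : ℝ => y ^ (-1 - 2 * s))]
    rw [finrank_E3]
    have h2 : IntegrableOn (fun y : ℝ => y ^ (1 - 2 * s)) (Set.Ioo 0 1) := by
      rw [intervalIntegral.integrableOn_Ioo_rpow_iff one_pos]
      linarith
    refine h2.congr_fun ?_ measurableSet_Ioo
    intro y hy
    have hy0 : 0 < y := hy.1
    simp only [smul_eq_mul]
    rw [← rpow_natCast, ← rpow_add hy0]
    congr 1
    norm_num
    ring
  have h3 := h.2
  rw [hasFiniteIntegral_iff_ofReal] at h3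
  · exact h3
  · exact Filter.Eventually.of_forall (fun z => by positivity)

lemma kernel_near_scale {s R : ℝ} (hR : 0 < R) :
    ∫⁻ z in Metric.ball (0 : E3) R, ENNReal.ofReal (‖z‖ ^ (-1 - 2 * s)) =
      ENNReal.ofReal (R ^ (2 - 2 * s)) *
        ∫⁻ z in Metric.ball (0 : E3) 1, ENNReal.ofReal (‖z‖ ^ (-1 - 2 * s)) := by
  have h := lint_smul ((Metric.ball (0 : E3) R).indicator
    (fun z => ENNReal.ofReal (‖z‖ ^ (-1 - 2 * s)))) hR
  rw [lintegral_indicator Metric.isOpen_ball.measurableSet] at h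
  have h2 : ∀ z : E3, (Metric.ball (0 : E3) R).indicator
      (fun z => ENNReal.ofReal (‖z‖ ^ (-1 - 2 * s))) (R • z) =
      ENNReal.ofReal (R ^ (-1 - 2 * s)) * (Metric.ball (0 : E3) 1).indicator
      (fun z => ENNReal.ofReal (‖z‖ ^ (-1 - 2 * s))) z := by
    intro z
    have e : R • z ∈ Metric.ball (0 : E3) R ↔ z ∈ Metric.ball (0 : E3) 1 := by
      simp only [mem_ball_zero_iff, norm_smul, Real.norm_eq_abs, abs_of_pos hR]
      constructor
      · intro h; nlinarith
      · intro h; nlinarith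
    by_cases hz : z ∈ Metric.ball (0 : E3) 1
    · rw [Set.indicator_of_mem hz, Set.indicator_of_mem (e.2 hz),
        ← ENNReal.ofReal_mul (by positivity), norm_smul, Real.norm_eq_abs, abs_of_pos hR,
        mul_rpow hR.le (norm_nonneg _)]
    · rw [Set.indicator_of_notMem hz, Set.indicator_of_notMem (fun h => hz (e.1 h)), mul_zero]
  simp_rw [h2] at h
  rw [lintegral_const_mul' _ _ ENNReal.ofReal_ne_top,
    lintegral_indicator Metric.isOpen_ball.measurableSet] at h
  have h3 := congrArg (fun x => ENNReal.ofReal (R ^ (3 : ℝ)) * x) h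
  simp only [← mul_assoc] at h3
  rw [← ENNReal.ofReal_mul (by positivity), ← ENNReal.ofReal_mul (by positivity),
    ← rpow_add hR, ← rpow_add hR] at h3
  norm_num at h3
  rw [← h3]
  congr 3
  ring

lemma kernel_far_fin {s : ℝ} (hs0 : 0 < s) :
    ∫⁻ z in (Metric.ball (0 : E3) 1)ᶜ, ENNReal.ofReal (‖z‖ ^ (-(3 + 2 * s))) < ∞ := by
  have h := finite_integral_one_add_norm (E := E3) (μ := volume) (r := 3 + 2 * s)
    (by rw [finrank_E3]; push_cast; linarith)
  have : ∫⁻ z in (Metric.ball (0 : E3) 1)ᶜ, ENNReal.ofReal (‖z‖ ^ (-(3 + 2 * s))) ≤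
      ∫⁻ z : E3, ENNReal.ofReal (2 ^ (3 + 2 * s)) * ENNReal.ofReal ((1 + ‖z‖) ^ (-(3 + 2 * s))) := by
    refine le_trans (setLIntegral_mono' Metric.isOpen_ball.measurableSet.compl ?_)
      (setLIntegral_le_lintegral _ _)
    intro z hz
    have hz1 : 1 ≤ ‖z‖ := by simpa using hz
    rw [← ENNReal.ofReal_mul (by positivity)]
    apply ENNReal.ofReal_le_ofReal
    rw [rpow_neg (by positivity), rpow_neg (by positivity), ← div_eq_mul_inv,
      ← div_rpow (by positivity) (by positivity), ← inv_rpow (by positivity)]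
    apply rpow_le_rpow (by positivity) _ (by linarith)
    rw [inv_eq_one_div, div_le_div_iff₀ (by positivity) (by positivity)]
    linarith
  refine this.trans_lt ?_
  rw [lintegral_const_mul' _ _ ENNReal.ofReal_ne_top]
  exact ENNReal.mul_lt_top ENNReal.ofReal_lt_top h

lemma gagE_fin {s : ℝ} (hs0 : 0 < s) (hs1 : s < 1) {g : E3 → ℝ} (hg : ContDiff ℝ 1 g)
    (hc : HasCompactSupport g) : gagE s g < ∞ := by
  obtain ⟨L, hL⟩ := hg.lipschitzWith_of_hasCompactSupport hc (by simp)
  obtain ⟨M, hM⟩ := hg.continuous.bounded_above_of_compact_support hc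
  set k : E3 → ℝ≥0∞ := fun z => (Metric.ball (0 : E3) 1).indicator
      (fun z => ENNReal.ofReal (L ^ 2) * ENNReal.ofReal (‖z‖ ^ (-1 - 2 * s))) z +
    ((Metric.ball (0 : E3) 1)ᶜ).indicator
      (fun z => ENNReal.ofReal ((2 * M) ^ 2) * ENNReal.ofReal (‖z‖ ^ (-(3 + 2 * s)))) z with hk
  have mb : MeasurableSet (Metric.ball (0 : E3) 1) := Metric.isOpen_ball.measurableSet
  have hkm : Measurable k := by
    apply Measurable.add
    · exact Measurable.indicator (by fun_prop) mb
    · exact Measurable.indicator (by fun_prop) mb.compl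
  have hki : ∫⁻ z, k z < ∞ := by
    rw [hk, lintegral_add_left (Measurable.indicator (by fun_prop) mb),
      lintegral_indicator mb, lintegral_indicator mb.compl,
      lintegral_const_mul' _ _ ENNReal.ofReal_ne_top,
      lintegral_const_mul' _ _ ENNReal.ofReal_ne_top]
    exact ENNReal.add_lt_top.2 ⟨ENNReal.mul_lt_top ENNReal.ofReal_lt_top (kernel_near_fin hs1),
      ENNReal.mul_lt_top ENNReal.ofReal_lt_top (kernel_far_fin hs0)⟩
  have hgk : ∀ v w, gk s g v w ≤ k (v - w) := by
    intro v w
    by_cases hvw : v = w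
    · simp [gk, hvw]
    have hp : 0 < ‖v - w‖ := norm_pos_iff.2 (sub_ne_zero.2 hvw)
    simp only [hk]
    by_cases hb : v - w ∈ Metric.ball (0 : E3) 1
    · rw [Set.indicator_of_mem hb, Set.indicator_of_notMem (by simpa using hb), add_zero,
        ← ENNReal.ofReal_mul (by positivity)]
      apply ENNReal.ofReal_le_ofReal
      have h1 : |g v - g w| ≤ L * ‖v - w‖ := by
        simpa [dist_eq_norm] using hL.dist_le_mul v w
      have h2 : (g v - g w) ^ 2 ≤ L ^ 2 * ‖v - w‖ ^ (2 : ℝ) := by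
        rw [← sq_abs, rpow_two, ← mul_pow]
        gcongr
      rw [div_le_iff₀ (by positivity), mul_assoc, ← rpow_add hp]
      have e2 : -1 - 2 * s + (3 + 2 * s) = 2 := by ring
      rw [e2]
      exact h2
    · rw [Set.indicator_of_notMem hb, Set.indicator_of_mem (by simpa using hb), zero_add,
        ← ENNReal.ofReal_mul (by positivity)]
      apply ENNReal.ofReal_le_ofReal
      rw [rpow_neg hp.le, ← div_eq_mul_inv]
      have h1 : |g v - g w| ≤ 2 * M := by
        have a1 := hM v
        have a2 := hM w
        rw [Real.norm_eq_abs] at a1 a2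
        exact (abs_sub _ _).trans (by linarith)
      refine div_le_div_of_nonneg_right ?_ (by positivity)
      rw [← sq_abs]
      gcongr
  set K := tsupport g
  have hK : volume K < ∞ := hc.isCompact.measure_lt_top
  have hKm : MeasurableSet K := (isClosed_tsupport g).measurableSet
  have hgk2 : ∀ v w, gk s g v w ≤ K.indicator 1 v * k (v - w) + K.indicator 1 w * k (v - w) := by
    intro v w
    by_cases hv : v ∈ K
    · rw [Set.indicator_of_mem hv]
      simp only [Pi.one_apply, one_mul]
      exact (hgk v w).trans le_self_add
    · by_cases hw : w ∈ K
      · rw [Set.indicator_of_mem hw]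
        simp only [Pi.one_apply, one_mul]
        exact (hgk v w).trans le_add_self
      · simp [gk, image_eq_zero_of_notMem_tsupport hv, image_eq_zero_of_notMem_tsupport hw]
  have hKi : Measurable (K.indicator (1 : E3 → ℝ≥0∞)) := measurable_one.indicator hKm
  calc gagE s g ≤ ∫⁻ v, ∫⁻ w, (K.indicator 1 v * k (v - w) + K.indicator 1 w * k (v - w)) := by
        unfold gagE
        gcongr with v w
        exact hgk2 v w
    _ = (∫⁻ v, ∫⁻ w, K.indicator 1 v * k (v - w)) + ∫⁻ v, ∫⁻ w, K.indicator 1 w * k (v - w) := by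
        rw [← lintegral_add_left]
        · congr 1; ext v
          rw [lintegral_add_left]
          fun_prop
        · apply Measurable.lintegral_prod_right'
            (f := fun p : E3 × E3 => K.indicator 1 p.1 * k (p.1 - p.2))
          fun_prop
    _ = volume K * (∫⁻ z, k z) + volume K * (∫⁻ z, k z) := by
        congr 1
        · have : ∀ v, ∫⁻ w, K.indicator 1 v * k (v - w) = K.indicator 1 v * ∫⁻ z, k z := by
            intro v
            rw [lintegral_const_mul _ (by fun_prop), lintegral_sub_left_eq_self k v]
          simp_rw [this]
          rw [lintegral_mul_const _ hKi, lintegral_indicator_one hKm]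
        · rw [lintegral_lintegral_swap (by fun_prop)]
          have : ∀ w, ∫⁻ v, K.indicator 1 w * k (v - w) = K.indicator 1 w * ∫⁻ z, k z := by
            intro v
            rw [lintegral_const_mul _ (by fun_prop), lintegral_sub_right_eq_self k v]
          simp_rw [this]
          rw [lintegral_mul_const _ hKi, lintegral_indicator_one hKm]
    _ < ∞ := ENNReal.add_lt_top.2 ⟨ENNReal.mul_lt_top hK hki, ENNReal.mul_lt_top hK hki⟩

lemma gagSq_eq {s : ℝ} {g : E3 → ℝ} (hg : Continuous g) (hfin : gagE s g < ∞) :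
    ENNReal.ofReal (gagSq s g) = gagE s g := by
  have hm := hg.measurable
  have h1 : ∀ v, ∫ w : E3, (g v - g w) ^ 2 / ‖v - w‖ ^ (3 + 2 * s) =
      (∫⁻ w, gk s g v w).toReal := by
    intro v
    rw [integral_eq_lintegral_of_nonneg_ae]
    · rfl
    · exact Filter.Eventually.of_forall (fun z => by positivity)
    · apply Measurable.aestronglyMeasurable
      fun_prop
  have hM : Measurable (fun v => ∫⁻ w, gk s g v w) := (gk_meas s hg).lintegral_prod_right'
  unfold gagSq
  simp_rw [h1]
  rw [integral_toReal hM.aemeasurable (ae_lt_top hM hfin.ne)]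
  exact ENNReal.ofReal_toReal hfin.ne

lemma one_le_jap (v : E3) : 1 ≤ jap v := by
  unfold jap
  rw [Real.one_le_sqrt]
  nlinarith [sq_nonneg ‖v‖]

lemma jap_pos (v : E3) : 0 < jap v := lt_of_lt_of_le one_pos (one_le_jap v)

lemma jap_sq (v : E3) : jap v ^ 2 = 1 + ‖v‖ ^ 2 := by
  unfold jap
  rw [Real.sq_sqrt (by positivity)]

lemma norm_le_jap (v : E3) : ‖v‖ ≤ jap v := by
  have := jap_sq v
  have := jap_pos v
  nlinarith [norm_nonneg v]

lemma jap_cont : Continuous jap := by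
  unfold jap
  fun_prop

lemma jap_meas : Measurable jap := jap_cont.measurable

lemma jap_sub_le (v w : E3) : jap v - jap w ≤ ‖v - w‖ := by
  have h1 := jap_sq v
  have h2 := jap_sq w
  have h3 := norm_le_jap v
  have h4 := norm_le_jap w
  have h5 := norm_sub_norm_le v w
  have h6 := jap_pos v
  have h7 := jap_pos w
  have h8 := norm_nonneg v
  have h9 := norm_nonneg w
  have h10 := norm_nonneg (v - w)
  by_contra! hcon
  have : (jap v - jap w) * (jap v + jap w) = (‖v‖ - ‖w‖) * (‖v‖ + ‖w‖) := by nlinarith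
  have a : ‖v - w‖ * (jap v + jap w) < (jap v - jap w) * (jap v + jap w) := by
    apply mul_lt_mul_of_pos_right hcon; linarith
  have b : (‖v‖ - ‖w‖) * (‖v‖ + ‖w‖) ≤ ‖v - w‖ * (‖v‖ + ‖w‖) := by gcongr
  have c : ‖v - w‖ * (‖v‖ + ‖w‖) ≤ ‖v - w‖ * (jap v + jap w) := by gcongr
  linarith

lemma abs_jap_sub_le (v w : E3) : |jap v - jap w| ≤ ‖v - w‖ := by
  rw [abs_le]
  constructor
  · have := jap_sub_le w v
    rw [norm_sub_rev] at this
    linarith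
  · exact jap_sub_le v w

lemma vol_ball (x : E3) {r : ℝ} (hr : 0 ≤ r) :
    volume (Metric.ball x r) = ENNReal.ofReal (r ^ 3) * volume (Metric.ball (0 : E3) 1) := by
  rw [Measure.addHaar_ball _ _ hr, finrank_E3]

lemma vol_closedBall (x : E3) {r : ℝ} (hr : 0 ≤ r) :
    volume (Metric.closedBall x r) = ENNReal.ofReal (r ^ 3) * volume (Metric.ball (0 : E3) 1) := by
  rw [Measure.addHaar_closedBall _ _ hr, finrank_E3]

/-- The unit vector used for shifting. -/
def eOne : E3 := EuclideanSpace.single 0 1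

lemma norm_eOne : ‖eOne‖ = 1 := by simp [eOne]

/-- Set of pairs `(v,w)` with `w` in a ball far away from the origin at scale `⟨v⟩`. -/
def hset : Set (E3 × E3) :=
  {p | dist p.2 ((3 * 2048 * jap p.1) • eOne) < 2048 * jap p.1}

lemma hset_meas : MeasurableSet hset := by
  apply IsOpen.measurableSet
  have := jap_cont
  exact isOpen_lt (by fun_prop) (by fun_prop)

lemma hset_bounds {v w : E3} (h : (v, w) ∈ hset) :
    2 * 2048 * jap v ≤ ‖w‖ ∧ ‖w‖ ≤ 4 * 2048 * jap v := by
  have h1 : dist w ((3 * 2048 * jap v) • eOne) < 2048 * jap v := h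
  have h2 : ‖(3 * 2048 * jap v) • eOne‖ = 3 * 2048 * jap v := by
    rw [norm_smul, norm_eOne, Real.norm_of_nonneg (by have := jap_pos v; positivity), mul_one]
  rw [dist_eq_norm] at h1
  have h3 := norm_sub_norm_le w ((3 * 2048 * jap v) • eOne)
  have h4 := norm_sub_norm_le ((3 * 2048 * jap v) • eOne) w
  rw [norm_sub_rev] at h4
  constructor <;> linarith

lemma hardy_real {s x j : ℝ} (hs0 : 0 < s) (hs1 : s < 1) (hx : 2 * 2048 ≤ x) (hj : 0 < j)
    (hjx : j ≤ 2 * x) :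
    (x / (4 * 2048)) ^ (-2 * s - 3) * (x / (2 * 2048)) ^ 3 ≤ (2048 ^ 3 / 4) * j ^ (-2 * s) := by
  have hx0 : 0 < x := by linarith
  have e1 : (x / (4 * 2048)) ^ (-2 * s - 3) * (x / (2 * 2048)) ^ 3 =
      8 * (x / (4 * 2048)) ^ (-2 * s) := by
    have : (x / (2 * 2048)) ^ 3 = 8 * (x / (4 * 2048)) ^ (3 : ℝ) := by
      norm_cast; ring
    rw [this, ← mul_assoc, mul_comm _ (8 : ℝ), mul_assoc, ← rpow_add (by positivity)]
    congr 2; ring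
  have e2 : (2 * x) ^ (-2 * s) ≤ j ^ (-2 * s) :=
    rpow_le_rpow_of_nonpos hj hjx (by linarith)
  have e3 : (x / (4 * 2048)) ^ (-2 * s) = (8 * 2048) ^ (2 * s) * (2 * x) ^ (-2 * s) := by
    have : x / (4 * 2048) = (2 * x) / (8 * 2048) := by ring
    rw [this, div_rpow (by positivity) (by positivity), div_eq_mul_inv, mul_comm,
      ← rpow_neg (by positivity)]
    congr 2; ring
  have e4 : ((8 : ℝ) * 2048) ^ (2 * s) ≤ (8 * 2048) ^ (2 : ℝ) :=
    rpow_le_rpow_of_exponent_le (by norm_num) (by linarith)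
  rw [e1, e3]
  calc 8 * ((8 * 2048 : ℝ) ^ (2 * s) * (2 * x) ^ (-2 * s))
      ≤ 8 * ((8 * 2048 : ℝ) ^ (2 : ℝ) * j ^ (-2 * s)) := by gcongr
    _ = _ := by norm_num; ring

lemma hardy {s : ℝ} (hs0 : 0 < s) (hs1 : s < 1) :
    ∃ C : ℝ, 0 < C ∧ ∀ g : E3 → ℝ, Continuous g → HasCompactSupport g →
      ∫⁻ v, ENNReal.ofReal (jap v ^ (-2 * s) * g v ^ 2) ≤ ENNReal.ofReal C * gagE s g := by
  set ω : ℝ := (volume (Metric.ball (0 : E3) 1)).toReal with hω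
  have hωf : volume (Metric.ball (0 : E3) 1) ≠ ∞ := measure_ball_lt_top.ne
  have hωe : volume (Metric.ball (0 : E3) 1) = ENNReal.ofReal ω := (ENNReal.ofReal_toReal hωf).symm
  have hω0 : 0 < ω := ENNReal.toReal_pos (Metric.measure_ball_pos volume _ one_pos).ne' hωf
  set D : ℝ := 2 * (5 * 2048) ^ (3 + 2 * s) with hD
  have hD0 : 0 < D := by positivity
  refine ⟨D / (2048 ^ 3 / 2 * ω), by positivity, ?_⟩
  intro g hg hc
  have hgm := hg.measurable
  have hjm := jap_meas
  set H := ∫⁻ v, ENNReal.ofReal (jap v ^ (-2 * s) * g v ^ 2) with hH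
  have hHfin : H ≠ ∞ := by
    have hcont : Continuous (fun v => jap v ^ (-2 * s) * g v ^ 2) := by
      apply Continuous.mul
      · exact jap_cont.rpow_const (fun v => Or.inl (jap_pos v).ne')
      · fun_prop
    have hcs : HasCompactSupport (fun v => jap v ^ (-2 * s) * g v ^ 2) := by
      apply HasCompactSupport.mul_left
      exact hc.comp_left (g := fun x => x ^ 2) (by simp)
    have hi := hcont.integrable_of_hasCompactSupport (μ := volume) hcs
    have h2 := hi.2
    rw [hasFiniteIntegral_iff_ofReal (Filter.Eventually.of_forall fun v => by
      have := jap_pos v; positivity)] at h2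
    exact h2.ne
  -- Step A
  have stepA : ENNReal.ofReal (2048 ^ 3 * ω) * H =
      ∫⁻ v, ∫⁻ w, hset.indicator (fun p => ENNReal.ofReal (jap p.1 ^ (-2 * s - 3) * g p.1 ^ 2))
        (v, w) := by
    rw [hH, ← lintegral_const_mul' _ _ ENNReal.ofReal_ne_top]
    congr 1; ext v
    have hj := jap_pos v
    have : ∀ w, hset.indicator (fun p => ENNReal.ofReal (jap p.1 ^ (-2 * s - 3) * g p.1 ^ 2))
        (v, w) = (Metric.ball ((3 * 2048 * jap v) • eOne) (2048 * jap v)).indicator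
        (fun _ => ENNReal.ofReal (jap v ^ (-2 * s - 3) * g v ^ 2)) w := fun w => rfl
    simp_rw [this]
    rw [lintegral_indicator Metric.isOpen_ball.measurableSet, setLIntegral_const,
      vol_ball _ (by positivity), hωe, ← ENNReal.ofReal_mul (by positivity),
      ← ENNReal.ofReal_mul (by positivity), ← ENNReal.ofReal_mul (by positivity)]
    congr 1
    have e : jap v ^ (-2 * s) = jap v ^ (-2 * s - 3) * jap v ^ 3 := by
      rw [← rpow_natCast, ← rpow_add hj]
      congr 1
      norm_num
    rw [e]
    ring
  -- Step B
  have stepB : ∀ v w, hset.indicator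
      (fun p => ENNReal.ofReal (jap p.1 ^ (-2 * s - 3) * g p.1 ^ 2)) (v, w) ≤
      ENNReal.ofReal 2 * hset.indicator (fun p => ENNReal.ofReal (jap p.1 ^ (-2 * s - 3) * g p.2 ^ 2)) (v, w) +
      ENNReal.ofReal D * gk s g v w := by
    intro v w
    by_cases hvw : (v, w) ∈ hset
    · rw [Set.indicator_of_mem hvw, Set.indicator_of_mem hvw]
      have hj := jap_pos v
      obtain ⟨b1, b2⟩ := hset_bounds hvw
      have hnv := norm_le_jap v
      have hne : 0 < ‖v - w‖ := by
        have := norm_sub_norm_le w v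
        rw [norm_sub_rev] at this
        linarith
      have hup : ‖v - w‖ ≤ 5 * 2048 * jap v := by
        have := norm_sub_le v w
        linarith
      unfold gk
      rw [← ENNReal.ofReal_mul (by positivity), ← ENNReal.ofReal_mul (by positivity),
        ← ENNReal.ofReal_add (by positivity) (by positivity)]
      apply ENNReal.ofReal_le_ofReal
      have k1 : jap v ^ (-2 * s - 3) ≤ (5 * 2048) ^ (3 + 2 * s) / ‖v - w‖ ^ (3 + 2 * s) := by
        rw [le_div_iff₀ (by positivity)]
        calc jap v ^ (-2 * s - 3) * ‖v - w‖ ^ (3 + 2 * s)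
            ≤ jap v ^ (-2 * s - 3) * (5 * 2048 * jap v) ^ (3 + 2 * s) := by gcongr
          _ = (5 * 2048) ^ (3 + 2 * s) * (jap v ^ (-2 * s - 3) * jap v ^ (3 + 2 * s)) := by
              rw [mul_rpow (by positivity) hj.le]; ring
          _ = _ := by
              rw [← rpow_add hj]
              have : -2 * s - 3 + (3 + 2 * s) = 0 := by ring
              rw [this, rpow_zero, mul_one]
      have k2 : g v ^ 2 ≤ 2 * g w ^ 2 + 2 * (g v - g w) ^ 2 := by
        nlinarith [sq_nonneg (g v - 2 * g w)]
      calc jap v ^ (-2 * s - 3) * g v ^ 2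
          ≤ jap v ^ (-2 * s - 3) * (2 * g w ^ 2 + 2 * (g v - g w) ^ 2) := by gcongr
        _ = 2 * (jap v ^ (-2 * s - 3) * g w ^ 2) +
            2 * (jap v ^ (-2 * s - 3) * (g v - g w) ^ 2) := by ring
        _ ≤ 2 * (jap v ^ (-2 * s - 3) * g w ^ 2) +
            2 * ((5 * 2048) ^ (3 + 2 * s) / ‖v - w‖ ^ (3 + 2 * s) * (g v - g w) ^ 2) := by gcongr
        _ = _ := by rw [hD]; ring
    · rw [Set.indicator_of_notMem hvw]
      exact zero_le
  -- Step C
  have mC : Measurable (hset.indicator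
      (fun p : E3 × E3 => ENNReal.ofReal (jap p.1 ^ (-2 * s - 3) * g p.2 ^ 2))) :=
    Measurable.indicator (by fun_prop) hset_meas
  have stepC : ∫⁻ v, ∫⁻ w, hset.indicator
      (fun p => ENNReal.ofReal (jap p.1 ^ (-2 * s - 3) * g p.2 ^ 2)) (v, w) ≤
      ENNReal.ofReal (2048 ^ 3 / 4 * ω) * H := by
    rw [lintegral_lintegral_swap (f := fun v w => hset.indicator
      (fun p => ENNReal.ofReal (jap p.1 ^ (-2 * s - 3) * g p.2 ^ 2)) (v, w)) mC.aemeasurable,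
      hH, ← lintegral_const_mul' _ _ ENNReal.ofReal_ne_top]
    apply lintegral_mono
    intro w
    beta_reduce
    by_cases hw : 2 * 2048 ≤ ‖w‖
    · calc
        _ ≤ ∫⁻ v, (Metric.closedBall (0 : E3) (‖w‖ / (2 * 2048))).indicator
            (fun _ => ENNReal.ofReal ((‖w‖ / (4 * 2048)) ^ (-2 * s - 3) * g w ^ 2)) v := by
            apply lintegral_mono
            intro v
            by_cases hvw : (v, w) ∈ hset
            · have hj := jap_pos v
              obtain ⟨b1, b2⟩ := hset_bounds hvw
              have hnv := norm_le_jap v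
              have hv : v ∈ Metric.closedBall (0 : E3) (‖w‖ / (2 * 2048)) := by
                rw [mem_closedBall_zero_iff, le_div_iff₀ (by norm_num)]
                linarith
              simp only [Set.indicator_of_mem hvw, Set.indicator_of_mem hv]
              apply ENNReal.ofReal_le_ofReal
              refine mul_le_mul_of_nonneg_right ?_ (sq_nonneg _)
              apply rpow_le_rpow_of_nonpos (by positivity) _ (by linarith)
              rw [div_le_iff₀ (by norm_num)]
              linarith
            · simp only [Set.indicator_of_notMem hvw]
              exact zero_le
        _ = ENNReal.ofReal ((‖w‖ / (4 * 2048)) ^ (-2 * s - 3) * g w ^ 2) *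
            (ENNReal.ofReal ((‖w‖ / (2 * 2048)) ^ 3) * ENNReal.ofReal ω) := by
            rw [lintegral_indicator Metric.isClosed_closedBall.measurableSet, setLIntegral_const,
              vol_closedBall _ (by positivity), hωe]
        _ ≤ _ := by
            have hjw := jap_pos w
            rw [← ENNReal.ofReal_mul (by positivity), ← ENNReal.ofReal_mul (by positivity),
              ← ENNReal.ofReal_mul (by positivity)]
            apply ENNReal.ofReal_le_ofReal
            have hjle : jap w ≤ 2 * ‖w‖ := by
              have := jap_sq w
              nlinarith
            have := hardy_real hs0 hs1 hw hjw hjle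
            calc _ = ((‖w‖ / (4 * 2048)) ^ (-2 * s - 3) * (‖w‖ / (2 * 2048)) ^ 3) *
                  (g w ^ 2 * ω) := by ring
              _ ≤ ((2048 ^ 3 / 4) * jap w ^ (-2 * s)) * (g w ^ 2 * ω) := by gcongr
              _ = _ := by ring
    · have : ∀ v, hset.indicator
          (fun p => ENNReal.ofReal (jap p.1 ^ (-2 * s - 3) * g p.2 ^ 2)) (v, w) = 0 := by
        intro v
        apply Set.indicator_of_notMem
        intro hvw
        obtain ⟨b1, b2⟩ := hset_bounds hvw
        have := one_le_jap v
        apply hw; linarith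
      simp only [this]
      simp
  have main : ENNReal.ofReal (2048 ^ 3 * ω) * H ≤
      ENNReal.ofReal (2048 ^ 3 / 2 * ω) * H + ENNReal.ofReal D * gagE s g := by
    calc _ = _ := stepA
      _ ≤ ∫⁻ v, ∫⁻ w, (ENNReal.ofReal 2 * hset.indicator
          (fun p => ENNReal.ofReal (jap p.1 ^ (-2 * s - 3) * g p.2 ^ 2)) (v, w) +
          ENNReal.ofReal D * gk s g v w) := by
          apply lintegral_mono; intro v
          apply lintegral_mono; intro w
          exact stepB v w
      _ = ENNReal.ofReal 2 * (∫⁻ v, ∫⁻ w, hset.indicator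
          (fun p => ENNReal.ofReal (jap p.1 ^ (-2 * s - 3) * g p.2 ^ 2)) (v, w)) +
          ENNReal.ofReal D * gagE s g := by
          unfold gagE
          rw [← lintegral_const_mul' _ _ (by simp), ← lintegral_const_mul' _ _ (by simp),
            ← lintegral_add_left]
          · congr 1; ext v
            rw [lintegral_add_left, lintegral_const_mul' _ _ (by simp),
              lintegral_const_mul' _ _ (by simp)]
            exact (mC.comp measurable_prodMk_left).const_mul _
          · exact (mC.lintegral_prod_right').const_mul _
      _ ≤ ENNReal.ofReal 2 * (ENNReal.ofReal (2048 ^ 3 / 4 * ω) * H) + ENNReal.ofReal D * gagE s g := by gcongr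
      _ = _ := by
          rw [← mul_assoc, ← ENNReal.ofReal_mul (by positivity)]
          congr 3; ring
  have split : ENNReal.ofReal (2048 ^ 3 * ω) * H = ENNReal.ofReal (2048 ^ 3 / 2 * ω) * H +
      ENNReal.ofReal (2048 ^ 3 / 2 * ω) * H := by
    rw [← add_mul, ← ENNReal.ofReal_add (by positivity) (by positivity)]
    congr 2; ring
  rw [split] at main
  have m2 : ENNReal.ofReal (2048 ^ 3 / 2 * ω) * H ≤ ENNReal.ofReal D * gagE s g :=
    (ENNReal.add_le_add_iff_left (ENNReal.mul_ne_top ENNReal.ofReal_ne_top hHfin)).1 main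
  have hq : (0 : ℝ) < 2048 ^ 3 / 2 * ω := by positivity
  calc H = ENNReal.ofReal ((2048 ^ 3 / 2 * ω)⁻¹) * (ENNReal.ofReal (2048 ^ 3 / 2 * ω) * H) := by
        rw [← mul_assoc, ← ENNReal.ofReal_mul (by positivity), inv_mul_cancel₀ hq.ne']
        simp
    _ ≤ ENNReal.ofReal ((2048 ^ 3 / 2 * ω)⁻¹) * (ENNReal.ofReal D * gagE s g) := by gcongr
    _ = _ := by
        rw [← mul_assoc, ← ENNReal.ofReal_mul (by positivity)]
        congr 2
        field_simp

lemma rpow_lip (a : ℝ) : ∃ L : ℝ, 0 ≤ L ∧ ∀ t ∈ Set.Icc (1/2 : ℝ) 2, |t ^ a - 1| ≤ L * |t - 1| := by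
  refine ⟨|a| * 2 ^ |a - 1|, by positivity, ?_⟩
  intro t ht
  have h := Convex.norm_image_sub_le_of_norm_hasDerivWithin_le (f := fun x : ℝ => x ^ a)
    (f' := fun x : ℝ => a * x ^ (a - 1)) (s := Set.Icc (1/2 : ℝ) 2) (x := 1) (y := t)
    (C := |a| * 2 ^ |a - 1|) ?_ ?_ (convex_Icc _ _) ⟨by norm_num, by norm_num⟩ ht
  · simpa using h
  · intro x hx
    have hx0 : 0 < x := lt_of_lt_of_le (by norm_num) hx.1
    exact (hasDerivAt_rpow_const (Or.inl hx0.ne')).hasDerivWithinAt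
  · intro x hx
    have hx0 : 0 < x := lt_of_lt_of_le (by norm_num) hx.1
    rw [norm_mul, Real.norm_eq_abs, Real.norm_of_nonneg (by positivity)]
    gcongr
    rcases le_total 0 (a - 1) with h | h
    · rw [abs_of_nonneg h]
      exact rpow_le_rpow hx0.le hx.2 h
    · rw [abs_of_nonpos h]
      calc x ^ (a - 1) ≤ (1/2 : ℝ) ^ (a - 1) := rpow_le_rpow_of_nonpos (by norm_num) hx.1 h
        _ = _ := by
          rw [one_div, inv_rpow (by norm_num), ← rpow_neg (by norm_num)]

/-- Localized Gagliardo energy density at scale `⟨v⟩/2`. -/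
def locE (s : ℝ) (f : E3 → ℝ) (v : E3) : ℝ≥0∞ :=
  ∫⁻ w in Metric.ball v (jap v / 2), gk s f v w

lemma locE_meas (s : ℝ) {f : E3 → ℝ} (hf : Continuous f) : Measurable (locE s f) := by
  have : locE s f = fun v => ∫⁻ w, ({p : E3 × E3 | dist p.2 p.1 < jap p.1 / 2}).indicator
      (fun p => gk s f p.1 p.2) (v, w) := by
    ext v
    unfold locE
    rw [← lintegral_indicator Metric.isOpen_ball.measurableSet]
    rfl
  rw [this]
  apply Measurable.lintegral_prod_right'
  apply (gk_meas s hf).indicator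
  have := jap_cont
  exact (isOpen_lt (by fun_prop) (by fun_prop)).measurableSet

lemma comm_point {s a L : ℝ} (hL : 0 ≤ L)
    (hLt : ∀ t ∈ Set.Icc (1/2 : ℝ) 2, |t ^ a - 1| ≤ L * |t - 1|) (f : E3 → ℝ) {v w : E3}
    (hw : w ∈ Metric.ball v (jap v / 2)) :
    ENNReal.ofReal (jap v ^ (2 * a)) * gk s f v w ≤
      ENNReal.ofReal 2 * gk s (fun x => jap x ^ a * f x) v w +
      ENNReal.ofReal (2 * L ^ 2) * (({p : E3 × E3 | dist p.1 p.2 < jap p.2}).indicator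
        (fun p => ENNReal.ofReal (jap p.2 ^ (-2 : ℝ) * (jap p.2 ^ a * f p.2) ^ 2) *
          ENNReal.ofReal (‖p.1 - p.2‖ ^ (-1 - 2 * s))) (v, w)) := by
  by_cases hvw : v = w
  · subst hvw
    simp [gk]
  have hp : 0 < ‖v - w‖ := norm_pos_iff.2 (sub_ne_zero.2 hvw)
  have hv := jap_pos v
  have hw0 := jap_pos w
  have hd : ‖v - w‖ < jap v / 2 := by
    rw [Metric.mem_ball, dist_eq_norm, norm_sub_rev] at hw
    exact hw
  have hj := abs_le.1 (abs_jap_sub_le v w)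
  have hin : (v, w) ∈ {p : E3 × E3 | dist p.1 p.2 < jap p.2} := by
    simp only [Set.mem_ofPred_eq, dist_eq_norm]
    linarith [hj.1, hj.2]
  rw [Set.indicator_of_mem hin]
  unfold gk
  rw [← ENNReal.ofReal_mul (by positivity), ← ENNReal.ofReal_mul (by positivity),
    ← ENNReal.ofReal_mul (by positivity), ← ENNReal.ofReal_mul (by positivity),
    ← ENNReal.ofReal_add (by positivity) (by positivity)]
  apply ENNReal.ofReal_le_ofReal
  dsimp only
  set t := jap v / jap w with ht
  have htm : t ∈ Set.Icc (1/2 : ℝ) 2 := by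
    constructor
    · rw [ht, le_div_iff₀ hw0]; linarith [hj.1, hj.2]
    · rw [ht, div_le_iff₀ hw0]; linarith [hj.1, hj.2]
  have h1 := hLt t htm
  have h2 : |t - 1| ≤ ‖v - w‖ / jap w := by
    have : t - 1 = (jap v - jap w) / jap w := by rw [ht]; field_simp
    rw [this, abs_div, abs_of_pos hw0]
    gcongr
    exact abs_jap_sub_le v w
  have h3 : |t ^ a - 1| ≤ L * (‖v - w‖ / jap w) := h1.trans (by gcongr)
  have h4 : (t ^ a - 1) ^ 2 ≤ L ^ 2 * (‖v - w‖ ^ 2 / jap w ^ 2) := by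
    rw [← sq_abs, ← div_pow, ← mul_pow]
    gcongr
  have hta : jap v ^ a = t ^ a * jap w ^ a := by
    rw [ht, ← mul_rpow (by positivity) hw0.le]
    congr 1; field_simp
  have h5 : jap v ^ (2 * a) * (f v - f w) ^ 2 ≤
      2 * (jap v ^ a * f v - jap w ^ a * f w) ^ 2 +
      2 * L ^ 2 * (‖v - w‖ ^ 2 / jap w ^ 2 * (jap w ^ a * f w) ^ 2) := by
    have e1 : jap v ^ (2 * a) = (jap v ^ a) ^ 2 := by
      rw [mul_comm, rpow_mul hv.le, rpow_two]
    have e2 : jap v ^ (2 * a) * (f v - f w) ^ 2 =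
        ((jap v ^ a * f v - jap w ^ a * f w) - (t ^ a - 1) * (jap w ^ a * f w)) ^ 2 := by
      rw [e1, ← mul_pow, hta]
      ring
    rw [e2]
    set X := jap v ^ a * f v - jap w ^ a * f w
    set Y := jap w ^ a * f w
    calc (X - (t ^ a - 1) * Y) ^ 2 ≤ 2 * X ^ 2 + 2 * ((t ^ a - 1) ^ 2 * Y ^ 2) := by
          nlinarith [sq_nonneg (X + (t ^ a - 1) * Y)]
      _ ≤ 2 * X ^ 2 + 2 * (L ^ 2 * (‖v - w‖ ^ 2 / jap w ^ 2) * Y ^ 2) := by gcongr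
      _ = _ := by ring
  have e3 : ‖v - w‖ ^ (-1 - 2 * s) = ‖v - w‖ ^ 2 / ‖v - w‖ ^ (3 + 2 * s) := by
    rw [eq_div_iff (by positivity), ← rpow_add hp, ← rpow_two]
    congr 1; ring
  have e4 : jap w ^ (-2 : ℝ) = 1 / jap w ^ 2 := by
    rw [rpow_neg hw0.le, rpow_two, one_div]
  rw [e3, e4, mul_div_assoc']
  calc _ ≤ (2 * (jap v ^ a * f v - jap w ^ a * f w) ^ 2 +
      2 * L ^ 2 * (‖v - w‖ ^ 2 / jap w ^ 2 * (jap w ^ a * f w) ^ 2)) / ‖v - w‖ ^ (3 + 2 * s) := by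
        gcongr
    _ = _ := by ring

lemma commut {s : ℝ} (hs0 : 0 < s) (hs1 : s < 1) (a : ℝ) :
    ∃ C : ℝ, 0 < C ∧ ∀ f : E3 → ℝ, Continuous f → HasCompactSupport f →
      ∫⁻ v, ENNReal.ofReal (jap v ^ (2 * a)) * locE s f v ≤
        ENNReal.ofReal C * gagE s (fun v => jap v ^ a * f v) := by
  obtain ⟨L, hL, hLt⟩ := rpow_lip a
  obtain ⟨CH, hCH, hardy⟩ := hardy hs0 hs1
  set J := ∫⁻ z in Metric.ball (0 : E3) 1, ENNReal.ofReal (‖z‖ ^ (-1 - 2 * s)) with hJ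
  have hJf : J ≠ ∞ := (kernel_near_fin hs1).ne
  refine ⟨2 + 2 * L ^ 2 * (J.toReal * CH), by positivity, ?_⟩
  intro f hf hc
  set g : E3 → ℝ := fun v => jap v ^ a * f v with hg
  have hgc : Continuous g :=
    (jap_cont.rpow_const (fun v => Or.inl (jap_pos v).ne')).mul hf
  have hgs : HasCompactSupport g := hc.mul_left
  have hgm := hgc.measurable
  have hjm := jap_meas
  set S : Set (E3 × E3) := {p : E3 × E3 | dist p.1 p.2 < jap p.2} with hS
  have hSm : MeasurableSet S := by
    have := jap_cont
    exact (isOpen_lt (by fun_prop) (by fun_prop)).measurableSet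
  set Q : E3 × E3 → ℝ≥0∞ := S.indicator
        (fun p => ENNReal.ofReal (jap p.2 ^ (-2 : ℝ) * g p.2 ^ 2) *
          ENNReal.ofReal (‖p.1 - p.2‖ ^ (-1 - 2 * s))) with hQ
  have hQm : Measurable Q := Measurable.indicator (by fun_prop) hSm
  have hQi : ∫⁻ v, ∫⁻ w, Q (v, w) = J * ∫⁻ w, ENNReal.ofReal (jap w ^ (-2 * s) * g w ^ 2) := by
    rw [lintegral_lintegral_swap (f := fun v w => Q (v, w)) hQm.aemeasurable,
      ← lintegral_const_mul' _ _ hJf]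
    congr 1; ext w
    have hw := jap_pos w
    have e1 : ∀ v, Q (v, w) = ENNReal.ofReal (jap w ^ (-2 : ℝ) * g w ^ 2) *
        (Metric.ball (0 : E3) (jap w)).indicator
          (fun z => ENNReal.ofReal (‖z‖ ^ (-1 - 2 * s))) (v - w) := by
      intro v
      by_cases h : (v, w) ∈ S
      · have h' : v - w ∈ Metric.ball (0 : E3) (jap w) := by
          rw [mem_ball_zero_iff, ← dist_eq_norm]; exact h
        rw [hQ, Set.indicator_of_mem h, Set.indicator_of_mem h']
      · have h' : v - w ∉ Metric.ball (0 : E3) (jap w) := by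
          rw [mem_ball_zero_iff, ← dist_eq_norm]; exact h
        rw [hQ, Set.indicator_of_notMem h, Set.indicator_of_notMem h', mul_zero]
    simp_rw [e1]
    rw [lintegral_const_mul' _ _ ENNReal.ofReal_ne_top,
      lintegral_sub_right_eq_self (fun x => (Metric.ball (0 : E3) (jap w)).indicator
          (fun z => ENNReal.ofReal (‖z‖ ^ (-1 - 2 * s))) x) w,
      lintegral_indicator Metric.isOpen_ball.measurableSet, kernel_near_scale hw, ← hJ,
      ← mul_assoc, ← ENNReal.ofReal_mul (by positivity), mul_comm]
    congr 2
    have : jap w ^ (-2 * s) = jap w ^ (-2 : ℝ) * jap w ^ (2 - 2 * s) := by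
      rw [← rpow_add hw]
      congr 1; ring
    rw [this]; ring
  calc ∫⁻ v, ENNReal.ofReal (jap v ^ (2 * a)) * locE s f v
      ≤ ∫⁻ v, ∫⁻ w, (ENNReal.ofReal 2 * gk s g v w + ENNReal.ofReal (2 * L ^ 2) * Q (v, w)) := by
        apply lintegral_mono
        intro v
        beta_reduce
        unfold locE
        rw [← lintegral_const_mul' _ _ ENNReal.ofReal_ne_top]
        refine le_trans (setLIntegral_mono' Metric.isOpen_ball.measurableSet ?_)
          (setLIntegral_le_lintegral _ _)
        intro w hw
        exact comm_point hL hLt f hw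
    _ = ENNReal.ofReal 2 * gagE s g + ENNReal.ofReal (2 * L ^ 2) * ∫⁻ v, ∫⁻ w, Q (v, w) := by
        unfold gagE
        rw [← lintegral_const_mul' _ _ ENNReal.ofReal_ne_top, ← lintegral_const_mul' _ _ ENNReal.ofReal_ne_top,
          ← lintegral_add_left]
        · congr 1; ext v
          rw [lintegral_add_left, lintegral_const_mul' _ _ ENNReal.ofReal_ne_top,
            lintegral_const_mul' _ _ ENNReal.ofReal_ne_top]
          exact (gk_meas' s hgc v).const_mul _
        · exact ((gk_meas s hgc).lintegral_prod_right').const_mul _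
    _ ≤ ENNReal.ofReal 2 * gagE s g +
        ENNReal.ofReal (2 * L ^ 2) * (J * (ENNReal.ofReal CH * gagE s g)) := by
        rw [hQi]
        gcongr
        exact hardy g hgc hgs
    _ = _ := by
        rw [← ENNReal.ofReal_toReal hJf, ENNReal.toReal_ofReal ENNReal.toReal_nonneg,
          ← mul_assoc (ENNReal.ofReal J.toReal),
          ← ENNReal.ofReal_mul ENNReal.toReal_nonneg, ← mul_assoc,
          ← ENNReal.ofReal_mul (by positivity), ← add_mul,
          ← ENNReal.ofReal_add (by positivity) (by positivity)]

lemma exists_bump : ∃ φ : E3 → ℝ, ContDiff ℝ 1 φ ∧ HasCompactSupport φ ∧ (∫ z, φ z = 1) ∧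
    ∃ M : ℝ, 0 < M ∧ (∀ z, |φ z| ≤ M) ∧ (∀ z, ‖fderiv ℝ φ z‖ ≤ M) ∧
    (∀ z, z ∉ Metric.ball (0 : E3) 1 → φ z = 0) ∧
    (∀ z, z ∉ Metric.ball (0 : E3) 1 → fderiv ℝ φ z = 0) := by
  let b : ContDiffBump (0 : E3) := ⟨1/4, 1/2, by norm_num, by norm_num⟩
  have h1 : ContDiff ℝ 1 (b.normed volume) := b.contDiff_normed
  have h2 : HasCompactSupport (b.normed volume) := b.hasCompactSupport_normed
  obtain ⟨M1, hM1⟩ := h1.continuous.bounded_above_of_compact_support h2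
  obtain ⟨M2, hM2⟩ := (h1.continuous_fderiv (by simp)).bounded_above_of_compact_support
    (h2.fderiv (𝕜 := ℝ))
  have hts : ∀ z, z ∉ Metric.ball (0 : E3) 1 → z ∉ tsupport (b.normed volume) := by
    intro z hz hz2
    rw [b.tsupport_normed_eq] at hz2
    apply hz
    have : (b.rOut : ℝ) = 1/2 := rfl
    rw [this] at hz2
    exact Metric.closedBall_subset_ball (by norm_num) hz2
  refine ⟨b.normed volume, h1, h2, b.integral_normed, max 1 (max M1 M2), by positivity, ?_, ?_,
    ?_, ?_⟩
  · intro z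
    exact (hM1 z).trans (by simp)
  · intro z
    exact (hM2 z).trans (by simp)
  · intro z hz
    exact image_eq_zero_of_notMem_tsupport (hts z hz)
  · intro z hz
    by_contra hne
    exact hts z hz (support_fderiv_subset ℝ hne)

lemma pd_cont {f : E3 → ℝ} (hf : ContDiff ℝ 1 f) (j : Fin 3) : Continuous (pd f j) := by
  unfold pd
  exact (hf.continuous_fderiv (by simp)).clm_apply continuous_const

lemma avg_formula {φ : E3 → ℝ} (hφ : ContDiff ℝ 1 φ) (hφc : HasCompactSupport φ)
    (hφi : ∫ z, φ z = 1) {f : E3 → ℝ} (hf : ContDiff ℝ 1 f) (j : Fin 3) (v : E3) {r : ℝ}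
    (hr : 0 < r) :
    pd f j v = ∫ z, (φ z * (pd f j v - pd f j (v + r • z)) -
      r⁻¹ * (pd φ j z * (f (v + r • z) - f v))) := by
  have hpc := pd_cont hf j
  have hfc := hf.continuous
  have hφcont := hφ.continuous
  have hpφ := pd_cont hφ j
  have hpφc : HasCompactSupport (pd φ j) :=
    (hφc.fderiv (𝕜 := ℝ)).comp_left (g := fun A : E3 →L[ℝ] ℝ => A (EuclideanSpace.single j 1))
      (by simp)
  set u : E3 → ℝ := fun z => f (v + r • z) - f v with hu
  have hud : ∀ z, fderiv ℝ u z (EuclideanSpace.single j 1) = r * pd f j (v + r • z) := by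
    intro z
    have d1 : HasFDerivAt (fun z : E3 => v + r • z) (r • ContinuousLinearMap.id ℝ E3) z :=
      ((hasFDerivAt_id z).const_smul r).const_add v
    have d2 : HasFDerivAt f (fderiv ℝ f (v + r • z)) (v + r • z) :=
      ((hf.differentiable (by simp)) _).hasFDerivAt
    have d3 : HasFDerivAt u _ z := (d2.comp z d1).sub_const (f v)
    rw [d3.fderiv]
    simp [pd]
  have i1 : Integrable (fun z => pd φ j z * u z) :=
    Continuous.integrable_of_hasCompactSupport (by fun_prop) hpφc.mul_right
  have i2 : Integrable (fun z => φ z * (r * pd f j (v + r • z))) :=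
    Continuous.integrable_of_hasCompactSupport (by fun_prop) hφc.mul_right
  have i2' : Integrable (fun z => φ z * pd f j (v + r • z)) :=
    Continuous.integrable_of_hasCompactSupport (by fun_prop) hφc.mul_right
  have i3 : Integrable (fun z => φ z * u z) :=
    Continuous.integrable_of_hasCompactSupport (by fun_prop) hφc.mul_right
  have i4 : Integrable φ := hφcont.integrable_of_hasCompactSupport hφc
  have ibp := integral_mul_fderiv_eq_neg_fderiv_mul_of_integrable (μ := (volume : Measure E3))
    (f := φ) (g := u) (v := EuclideanSpace.single j (1 : ℝ)) (by exact i1)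
    (by simp_rw [hud]; exact i2) i3 (fun x _ => hφ.differentiable (by simp) x)
    (by
      have : ContDiff ℝ 1 u := by
        apply ContDiff.sub _ contDiff_const
        apply hf.comp
        fun_prop
      exact fun x _ => this.differentiable (by simp) x)
  simp_rw [hud] at ibp
  have e1 : ∫ z, φ z * (r * pd f j (v + r • z)) = r * ∫ z, φ z * pd f j (v + r • z) := by
    rw [← integral_const_mul]
    congr 1; ext z; ring
  rw [e1] at ibp
  have e2 : ∀ z, (φ z * (pd f j v - pd f j (v + r • z)) -
      r⁻¹ * (pd φ j z * (f (v + r • z) - f v))) =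
      (φ z * pd f j v - φ z * pd f j (v + r • z)) - r⁻¹ * (pd φ j z * u z) := by
    intro z; rw [hu]; ring
  simp_rw [e2]
  have i5 : Integrable (fun z => φ z * pd f j v) := i4.mul_const _
  have i6 : Integrable (fun z => φ z * pd f j v - φ z * pd f j (v + r • z)) := i5.sub i2'
  have i7 : Integrable (fun z => r⁻¹ * (pd φ j z * u z)) := i1.const_mul _
  rw [integral_sub i6 i7, integral_sub i5 i2',
    integral_mul_const, hφi, one_mul, integral_const_mul]
  have e3 : ∫ z, pd φ j z * u z = -(r * ∫ z, φ z * pd f j (v + r • z)) := by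
    rw [ibp, neg_neg]; rfl
  rw [e3]
  field_simp
  ring

lemma cs_ball (h : E3 → ℝ≥0∞) (hm : Measurable h) (B : Set E3) :
    (∫⁻ z in B, h z) ^ 2 ≤ volume B * ∫⁻ z in B, h z ^ 2 := by
  have := ENNReal.lintegral_mul_norm_pow_le (μ := volume.restrict B) (f := fun z => h z ^ 2)
    (g := fun _ => 1) (p := 1/2) (q := 1/2) (by fun_prop) (by fun_prop)
    (by norm_num) (by norm_num) (by norm_num)
  have e : ∀ z, (h z ^ 2) ^ (1/2 : ℝ) = h z := by
    intro z
    rw [← ENNReal.rpow_natCast, ← ENNReal.rpow_mul]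
    norm_num
  simp only [e, ENNReal.one_rpow, mul_one, lintegral_const, one_mul, Measure.restrict_apply_univ]
    at this
  calc _ ≤ ((∫⁻ z in B, h z ^ 2) ^ (1/2 : ℝ) * volume B ^ (1/2 : ℝ)) ^ 2 := by gcongr
    _ = _ := by
      rw [mul_pow, ← ENNReal.rpow_natCast, ← ENNReal.rpow_natCast, ← ENNReal.rpow_mul,
        ← ENNReal.rpow_mul]
      norm_num
      rw [mul_comm]

lemma ball_scale {s : ℝ} (hs0 : 0 < s) (u : E3 → ℝ) (v : E3) {r : ℝ} (hr : 0 < r) :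
    ∫⁻ z in Metric.ball (0 : E3) 1, ENNReal.ofReal ((u v - u (v + r • z)) ^ 2) ≤
      ENNReal.ofReal (r ^ (2 * s)) * ∫⁻ w in Metric.ball v r, gk s u v w := by
  have mb : MeasurableSet (Metric.ball (0 : E3) 1) := Metric.isOpen_ball.measurableSet
  have mb' : MeasurableSet (Metric.ball v r) := Metric.isOpen_ball.measurableSet
  set k : E3 → ℝ≥0∞ := (Metric.ball v r).indicator (fun w => gk s u v w) with hk
  have h1 : ∫⁻ z, k (v + r • z) = ENNReal.ofReal (r ^ (-3 : ℝ)) * ∫⁻ w in Metric.ball v r, gk s u v w := by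
    rw [lint_smul (fun y => k (v + y)) hr, lintegral_add_left_eq_self k v, hk,
      lintegral_indicator mb']
  calc _ = ∫⁻ z, (Metric.ball (0 : E3) 1).indicator
        (fun z => ENNReal.ofReal ((u v - u (v + r • z)) ^ 2)) z := by
        rw [lintegral_indicator mb]
    _ ≤ ∫⁻ z, ENNReal.ofReal (r ^ (3 + 2 * s)) * k (v + r • z) := by
        apply lintegral_mono
        intro z
        beta_reduce
        by_cases hz : z ∈ Metric.ball (0 : E3) 1
        · have hz1 : ‖z‖ < 1 := by simpa using hz
          have hn : ‖v - (v + r • z)‖ = r * ‖z‖ := by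
            rw [sub_add_cancel_left, norm_neg, norm_smul, Real.norm_of_nonneg hr.le]
          have hz' : v + r • z ∈ Metric.ball v r := by
            rw [Metric.mem_ball, dist_comm, dist_eq_norm, hn]
            nlinarith
          rw [Set.indicator_of_mem hz, hk, Set.indicator_of_mem hz']
          by_cases hz0 : z = 0
          · simp [hz0]
          have hzp : 0 < ‖z‖ := norm_pos_iff.2 hz0
          unfold gk
          rw [← ENNReal.ofReal_mul (by positivity), hn]
          apply ENNReal.ofReal_le_ofReal
          rw [mul_div_assoc', le_div_iff₀ (by positivity), mul_comm]
          gcongr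
          nlinarith
        · rw [Set.indicator_of_notMem hz]
          exact zero_le
    _ = _ := by
        rw [lintegral_const_mul' _ _ ENNReal.ofReal_ne_top, h1, ← mul_assoc,
          ← ENNReal.ofReal_mul (by positivity), ← rpow_add hr]
        congr 3; ring

lemma avg_bound {s : ℝ} (hs0 : 0 < s) : ∃ C : ℝ, 0 < C ∧ ∀ f : E3 → ℝ, ContDiff ℝ 1 f →
    ∀ (j : Fin 3) (v : E3) (r : ℝ), 0 < r → ENNReal.ofReal (pd f j v ^ 2) ≤
      ENNReal.ofReal C * (ENNReal.ofReal (r ^ (2 * s)) * ∫⁻ w in Metric.ball v r, gk s (pd f j) v w) +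
      ENNReal.ofReal C * (ENNReal.ofReal (r ^ (2 * s - 2)) * ∫⁻ w in Metric.ball v r, gk s f v w) := by
  obtain ⟨φ, hφ, hφc, hφi, M, hM0, hM1, hM2, hz1, hz2⟩ := exists_bump
  set ω : ℝ := (volume (Metric.ball (0 : E3) 1)).toReal with hω
  have hωf : volume (Metric.ball (0 : E3) 1) ≠ ∞ := measure_ball_lt_top.ne
  have hωe : volume (Metric.ball (0 : E3) 1) = ENNReal.ofReal ω := (ENNReal.ofReal_toReal hωf).symm
  have hω0 : 0 < ω := ENNReal.toReal_pos (Metric.measure_ball_pos volume _ one_pos).ne' hωf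
  have mb : MeasurableSet (Metric.ball (0 : E3) 1) := Metric.isOpen_ball.measurableSet
  refine ⟨ω * (2 * M ^ 2), by positivity, ?_⟩
  intro f hf j v r hr
  have hpm := (pd_cont hf j).measurable
  have hfm := hf.continuous.measurable
  set h : E3 → ℝ≥0∞ := fun z => ENNReal.ofReal (M * (|pd f j v - pd f j (v + r • z)| +
    r⁻¹ * |f v - f (v + r • z)|)) with hh
  have hhm : Measurable h := by
    have e1 : Measurable (fun z : E3 => |pd f j v - pd f j (v + r • z)|) := by
      simp_rw [← Real.norm_eq_abs]; fun_prop
    have e2 : Measurable (fun z : E3 => |f v - f (v + r • z)|) := by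
      simp_rw [← Real.norm_eq_abs]; fun_prop
    fun_prop
  have b1 : ENNReal.ofReal |pd f j v| ≤ ∫⁻ z in Metric.ball (0 : E3) 1, h z := by
    rw [← Real.norm_eq_abs, ofReal_norm, avg_formula hφ hφc hφi hf j v hr]
    refine (enorm_integral_le_lintegral_enorm _).trans ?_
    rw [← lintegral_indicator mb]
    apply lintegral_mono
    intro z
    beta_reduce
    by_cases hz : z ∈ Metric.ball (0 : E3) 1
    · rw [Set.indicator_of_mem hz, ← ofReal_norm]
      apply ENNReal.ofReal_le_ofReal
      have hpd : |pd φ j z| ≤ M := by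
        have := (fderiv ℝ φ z).le_opNorm (EuclideanSpace.single j 1)
        simp only [PiLp.norm_single, norm_one, mul_one] at this
        exact this.trans (hM2 z)
      refine (norm_sub_le _ _).trans ?_
      rw [norm_mul, norm_mul, norm_mul, Real.norm_eq_abs, Real.norm_eq_abs, Real.norm_eq_abs,
        Real.norm_eq_abs, Real.norm_eq_abs, abs_of_pos (inv_pos.2 hr), abs_sub_comm (f (v + r • z))]
      calc _ ≤ M * |pd f j v - pd f j (v + r • z)| + r⁻¹ * (M * |f v - f (v + r • z)|) := by
            gcongr
            exact hM1 z
        _ = _ := by ring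
    · rw [Set.indicator_of_notMem hz, hz1 z hz]
      have : pd φ j z = 0 := by
        unfold pd; rw [hz2 z hz]; simp
      rw [this]
      simp
  have b2 : ENNReal.ofReal (pd f j v ^ 2) ≤
      ENNReal.ofReal ω * ∫⁻ z in Metric.ball (0 : E3) 1, h z ^ 2 := by
    rw [← hωe]
    refine le_trans ?_ (cs_ball h hhm _)
    rw [← sq_abs, ENNReal.ofReal_pow (abs_nonneg _)]
    gcongr
  have b3 : ∀ z, h z ^ 2 ≤ ENNReal.ofReal (2 * M ^ 2) *
      ENNReal.ofReal ((pd f j v - pd f j (v + r • z)) ^ 2) +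
      ENNReal.ofReal (2 * M ^ 2 * r ^ (-2 : ℝ)) * ENNReal.ofReal ((f v - f (v + r • z)) ^ 2) := by
    intro z
    rw [hh, ← ENNReal.ofReal_pow (by positivity), ← ENNReal.ofReal_mul (by positivity),
      ← ENNReal.ofReal_mul (by positivity), ← ENNReal.ofReal_add (by positivity) (by positivity)]
    apply ENNReal.ofReal_le_ofReal
    rw [rpow_neg hr.le, rpow_two, ← sq_abs (pd f j v - pd f j (v + r • z)),
      ← sq_abs (f v - f (v + r • z))]
    set X := |pd f j v - pd f j (v + r • z)|
    set Y := |f v - f (v + r • z)|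
    have : (X + r⁻¹ * Y) ^ 2 ≤ 2 * X ^ 2 + 2 * (r⁻¹ * Y) ^ 2 := by
      nlinarith [sq_nonneg (X - r⁻¹ * Y)]
    calc (M * (X + r⁻¹ * Y)) ^ 2 = M ^ 2 * (X + r⁻¹ * Y) ^ 2 := by ring
      _ ≤ M ^ 2 * (2 * X ^ 2 + 2 * (r⁻¹ * Y) ^ 2) := by gcongr
      _ = _ := by rw [mul_pow, inv_pow]; ring
  have m1 : Measurable (fun z : E3 => ENNReal.ofReal (2 * M ^ 2) *
      ENNReal.ofReal ((pd f j v - pd f j (v + r • z)) ^ 2)) := by fun_prop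
  calc ENNReal.ofReal (pd f j v ^ 2)
      ≤ ENNReal.ofReal ω * ∫⁻ z in Metric.ball (0 : E3) 1, h z ^ 2 := b2
    _ ≤ ENNReal.ofReal ω * ∫⁻ z in Metric.ball (0 : E3) 1, (ENNReal.ofReal (2 * M ^ 2) *
      ENNReal.ofReal ((pd f j v - pd f j (v + r • z)) ^ 2) +
      ENNReal.ofReal (2 * M ^ 2 * r ^ (-2 : ℝ)) * ENNReal.ofReal ((f v - f (v + r • z)) ^ 2)) := by
        refine mul_le_mul_right (lintegral_mono fun z => b3 z) _
    _ = ENNReal.ofReal ω * (ENNReal.ofReal (2 * M ^ 2) *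
        (∫⁻ z in Metric.ball (0 : E3) 1, ENNReal.ofReal ((pd f j v - pd f j (v + r • z)) ^ 2)) +
        ENNReal.ofReal (2 * M ^ 2 * r ^ (-2 : ℝ)) *
        ∫⁻ z in Metric.ball (0 : E3) 1, ENNReal.ofReal ((f v - f (v + r • z)) ^ 2)) := by
        rw [lintegral_add_left m1, lintegral_const_mul' _ _ ENNReal.ofReal_ne_top,
          lintegral_const_mul' _ _ ENNReal.ofReal_ne_top]
    _ ≤ ENNReal.ofReal ω * (ENNReal.ofReal (2 * M ^ 2) *
        (ENNReal.ofReal (r ^ (2 * s)) * ∫⁻ w in Metric.ball v r, gk s (pd f j) v w) +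
        ENNReal.ofReal (2 * M ^ 2 * r ^ (-2 : ℝ)) *
        (ENNReal.ofReal (r ^ (2 * s)) * ∫⁻ w in Metric.ball v r, gk s f v w)) := by
        gcongr
        · exact ball_scale hs0 (pd f j) v hr
        · exact ball_scale hs0 f v hr
    _ = _ := by
        rw [mul_add]
        congr 1
        · rw [← mul_assoc, ← ENNReal.ofReal_mul (by positivity)]
        · rw [← mul_assoc, ← mul_assoc, ← mul_assoc, ← ENNReal.ofReal_mul (by positivity),
            ← ENNReal.ofReal_mul (by positivity), ← ENNReal.ofReal_mul (by positivity)]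
          congr 2
          have : r ^ (2 * s - 2) = r ^ (-2 : ℝ) * r ^ (2 * s) := by
            rw [← rpow_add hr]; congr 1; ring
          rw [this]; ring

lemma interp_real {s P F G ρ C : ℝ} (hs0 : 0 < s) (hs1 : s < 1) (hP : 0 ≤ P) (hF : 0 ≤ F)
    (hG : 0 ≤ G) (hρ : 0 < ρ) (hC : 0 < C)
    (h : ∀ r, 0 < r → r ≤ ρ → P ≤ C * (r ^ (2 * s) * G) + C * (r ^ (2 * s - 2) * F)) :
    P ≤ (2 * C + 1) * (F ^ s * (G + ρ ^ (-2 * s) * P) ^ (1 - s)) := by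
  rcases hP.eq_or_lt with hP0 | hP0
  · rw [← hP0]; positivity
  set G' := G + ρ ^ (-2 * s) * P with hG'
  have hG'0 : 0 < G' := by positivity
  have hGG : G ≤ G' := by rw [hG']; have : 0 < ρ ^ (-2 * s) * P := by positivity
                          linarith
  have hPG : P ≤ ρ ^ (2 * s) * G' := by
    have e : ρ ^ (2 * s) * (ρ ^ (-2 * s) * P) = P := by
      rw [← mul_assoc, ← rpow_add hρ]
      have : 2 * s + -2 * s = 0 := by ring
      rw [this, rpow_zero, one_mul]
    calc P = ρ ^ (2 * s) * (ρ ^ (-2 * s) * P) := e.symm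
      _ ≤ _ := by
        rw [hG']
        gcongr
        linarith
  rcases hF.eq_or_lt with hF0 | hF0
  · exfalso
    set q := P / (2 * C * (G + 1)) with hq
    have hq0 : 0 < q := by positivity
    set r := min ρ (q ^ (1 / (2 * s))) with hr
    have hr0 : 0 < r := lt_min hρ (by positivity)
    have h1 := h r hr0 (min_le_left _ _)
    rw [← hF0, mul_zero, mul_zero, add_zero] at h1
    have h2 : r ^ (2 * s) ≤ q := by
      calc r ^ (2 * s) ≤ (q ^ (1 / (2 * s))) ^ (2 * s) := by
            gcongr
            exact min_le_right _ _
        _ = q := by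
            rw [← rpow_mul hq0.le]
            have : 1 / (2 * s) * (2 * s) = 1 := by field_simp
            rw [this, rpow_one]
    have h3 : C * (r ^ (2 * s) * G) ≤ C * (q * G) := by gcongr
    have h4 : C * (q * (G + 1)) = P / 2 := by
      rw [hq]; field_simp
    nlinarith
  rcases le_or_gt F (ρ ^ 2 * G') with hc | hc
  · set r := (F / G') ^ (1/2 : ℝ) with hr
    have hr0 : 0 < r := by positivity
    have hrρ : r ≤ ρ := by
      have : F / G' ≤ ρ ^ (2 : ℝ) := by rw [rpow_two, div_le_iff₀ hG'0]; exact hc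
      calc r ≤ (ρ ^ (2 : ℝ)) ^ (1/2 : ℝ) := by rw [hr]; gcongr
        _ = ρ := by rw [← rpow_mul hρ.le]; norm_num
    have h1 := h r hr0 hrρ
    have e1 : r ^ (2 * s) = (F / G') ^ s := by
      rw [hr, ← rpow_mul (by positivity)]; congr 1; ring
    have e2 : r ^ (2 * s - 2) = (F / G') ^ (s - 1) := by
      rw [hr, ← rpow_mul (by positivity)]; congr 1; ring
    have e3 : (F / G') ^ s * G' = F ^ s * G' ^ (1 - s) := by
      rw [div_rpow hF0.le hG'0.le, rpow_sub hG'0, rpow_one]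
      field_simp
    have e4 : (F / G') ^ (s - 1) * F = F ^ s * G' ^ (1 - s) := by
      rw [← e3, rpow_sub (by positivity), rpow_one]
      field_simp
    rw [e1, e2, e4] at h1
    have h2 : (F / G') ^ s * G ≤ F ^ s * G' ^ (1 - s) := by
      rw [← e3]; gcongr
    have h3 : 0 ≤ F ^ s * G' ^ (1 - s) := by positivity
    nlinarith
  · have h1 := h ρ hρ le_rfl
    have h2 : P ≤ 2 * C * (ρ ^ (2 * s - 2) * F) := by
      have e : ρ ^ (2 * s) * G' ≤ ρ ^ (2 * s - 2) * F := by
        have : ρ ^ (2 * s) = ρ ^ (2 * s - 2) * ρ ^ 2 := by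
          rw [← rpow_two, ← rpow_add hρ]; congr 1; ring
        rw [this, mul_assoc]
        gcongr
      have e2 : ρ ^ (2 * s) * G ≤ ρ ^ (2 * s) * G' := by gcongr
      nlinarith
    have e0 : P = P ^ s * P ^ (1 - s) := by
      rw [← rpow_add hP0]
      have : s + (1 - s) = 1 := by ring
      rw [this, rpow_one]
    calc P = P ^ s * P ^ (1 - s) := e0
      _ ≤ (2 * C * (ρ ^ (2 * s - 2) * F)) ^ s * (ρ ^ (2 * s) * G') ^ (1 - s) := by
          gcongr
      _ = (2 * C) ^ s * ((ρ ^ (2 * s - 2)) ^ s * (ρ ^ (2 * s)) ^ (1 - s)) *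
          (F ^ s * G' ^ (1 - s)) := by
          rw [mul_rpow (by positivity) (by positivity), mul_rpow (by positivity) hF0.le,
            mul_rpow (by positivity) hG'0.le]
          ring
      _ = (2 * C) ^ s * (F ^ s * G' ^ (1 - s)) := by
          rw [← rpow_mul hρ.le, ← rpow_mul hρ.le, ← rpow_add hρ]
          have : (2 * s - 2) * s + 2 * s * (1 - s) = 0 := by ring
          rw [this, rpow_zero, mul_one]
      _ ≤ _ := by
          gcongr
          calc (2 * C) ^ s ≤ (2 * C + 1) ^ s := by gcongr; linarith
            _ ≤ (2 * C + 1) ^ (1 : ℝ) :=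
              rpow_le_rpow_of_exponent_le (by linarith) hs1.le
            _ = _ := rpow_one _

lemma interp_point {s : ℝ} (hs0 : 0 < s) (hs1 : s < 1) : ∃ K : ℝ, 0 < K ∧
    ∀ f : E3 → ℝ, ContDiff ℝ 1 f → ∀ (j : Fin 3) (v : E3), locE s f v < ∞ →
    locE s (pd f j) v < ∞ →
    ENNReal.ofReal (pd f j v ^ 2) ≤ ENNReal.ofReal K * (locE s f v ^ s *
      (locE s (pd f j) v + ENNReal.ofReal ((jap v / 2) ^ (-2 * s) * pd f j v ^ 2)) ^ (1 - s)) := by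
  obtain ⟨C, hC, hb⟩ := avg_bound hs0
  refine ⟨2 * C + 1, by positivity, ?_⟩
  intro f hf j v hF hG
  have hρ : 0 < jap v / 2 := by have := jap_pos v; positivity
  set F := (locE s f v).toReal with hFd
  set G := (locE s (pd f j) v).toReal with hGd
  have eF : locE s f v = ENNReal.ofReal F := (ENNReal.ofReal_toReal hF.ne).symm
  have eG : locE s (pd f j) v = ENNReal.ofReal G := (ENNReal.ofReal_toReal hG.ne).symm
  have hF0 : 0 ≤ F := ENNReal.toReal_nonneg
  have hG0 : 0 ≤ G := ENNReal.toReal_nonneg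
  have key := interp_real hs0 hs1 (sq_nonneg (pd f j v)) hF0 hG0 hρ hC (by
    intro r hr hrρ
    have h1 := hb f hf j v r hr
    have l1 : ∫⁻ w in Metric.ball v r, gk s (pd f j) v w ≤ ENNReal.ofReal G := by
      rw [← eG]; exact lintegral_mono_set (Metric.ball_subset_ball hrρ)
    have l2 : ∫⁻ w in Metric.ball v r, gk s f v w ≤ ENNReal.ofReal F := by
      rw [← eF]; exact lintegral_mono_set (Metric.ball_subset_ball hrρ)
    have h2 : ENNReal.ofReal (pd f j v ^ 2) ≤
        ENNReal.ofReal C * (ENNReal.ofReal (r ^ (2 * s)) * ENNReal.ofReal G) +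
        ENNReal.ofReal C * (ENNReal.ofReal (r ^ (2 * s - 2)) * ENNReal.ofReal F) :=
      h1.trans (by gcongr)
    rw [← ENNReal.ofReal_mul (by positivity), ← ENNReal.ofReal_mul (by positivity),
      ← ENNReal.ofReal_mul (by positivity), ← ENNReal.ofReal_mul (by positivity),
      ← ENNReal.ofReal_add (by positivity) (by positivity),
      ENNReal.ofReal_le_ofReal_iff (by positivity)] at h2
    exact h2)
  have := ENNReal.ofReal_le_ofReal key
  rw [eF, eG, ← ENNReal.ofReal_add hG0 (by positivity), ENNReal.ofReal_rpow_of_nonneg hF0 hs0.le,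
    ENNReal.ofReal_rpow_of_nonneg (by positivity) (by linarith),
    ← ENNReal.ofReal_mul (by positivity), ← ENNReal.ofReal_mul (by positivity)]
  exact this

lemma component_bound {s : ℝ} (hs0 : 0 < s) (hs1 : s < 1) (a b c : ℝ)
    (habc : b = s * a + (1 - s) * c) : ∃ K : ℝ, 0 < K ∧
    ∀ f : E3 → ℝ, ContDiff ℝ 2 f → HasCompactSupport f → ∀ (j : Fin 3),
    ∫⁻ v, ENNReal.ofReal (jap v ^ (2 * b) * pd f j v ^ 2) ≤ ENNReal.ofReal K *
      (gagE s (fun v => jap v ^ a * f v) ^ s *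
        gagE s (fun v => jap v ^ c * pd f j v) ^ (1 - s)) := by
  obtain ⟨K, hK, hintg⟩ := interp_point hs0 hs1
  obtain ⟨CA, hCA, hA⟩ := commut hs0 hs1 a
  obtain ⟨CC, hCC, hCo⟩ := commut hs0 hs1 c
  obtain ⟨CH, hCH, hH⟩ := hardy hs0 hs1
  refine ⟨K * (CA ^ s * (CC + 2 ^ (2 * s) * CH) ^ (1 - s)), by positivity, ?_⟩
  intro f hf2 hc j
  have hf : ContDiff ℝ 1 f := hf2.of_le (by norm_num)
  have hp1 : ContDiff ℝ 1 (pd f j) := by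
    unfold pd
    exact (hf2.fderiv_right (m := 1) (by norm_num)).clm_apply contDiff_const
  have hpc : HasCompactSupport (pd f j) :=
    (hc.fderiv (𝕜 := ℝ)).comp_left (g := fun A : E3 →L[ℝ] ℝ => A (EuclideanSpace.single j 1))
      (by simp)
  have hpcont := hp1.continuous
  have hpm := hpcont.measurable
  have hjm := jap_meas
  have locfin : ∀ u : E3 → ℝ, ContDiff ℝ 1 u → HasCompactSupport u →
      ∀ᵐ v, locE s u v < ∞ := by
    intro u hu huc
    have h1 := gagE_fin hs0 hs1 hu huc
    have hM : Measurable (fun v => ∫⁻ w, gk s u v w) :=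
      (gk_meas s hu.continuous).lintegral_prod_right'
    filter_upwards [ae_lt_top hM h1.ne] with v hv
    exact lt_of_le_of_lt (setLIntegral_le_lintegral _ _) hv
  set X : E3 → ℝ≥0∞ := fun v => ENNReal.ofReal (jap v ^ (2 * a)) * locE s f v with hX
  set Y : E3 → ℝ≥0∞ := fun v => ENNReal.ofReal (jap v ^ (2 * c)) * locE s (pd f j) v +
    ENNReal.ofReal (2 ^ (2 * s)) * ENNReal.ofReal (jap v ^ (-2 * s) * (jap v ^ c * pd f j v) ^ 2)
    with hY
  have m1 := locE_meas s hf.continuous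
  have m2 := locE_meas s hpcont
  have hXm : Measurable X := by fun_prop
  have hYm : Measurable Y := by fun_prop
  have hpt : ∀ᵐ v, ENNReal.ofReal (jap v ^ (2 * b) * pd f j v ^ 2) ≤
      ENNReal.ofReal K * (X v ^ s * Y v ^ (1 - s)) := by
    filter_upwards [locfin f hf hc, locfin _ hp1 hpc] with v h1 h2
    have hj := jap_pos v
    have h3 := hintg f hf j v h1 h2
    have eY : Y v = ENNReal.ofReal (jap v ^ (2 * c)) * (locE s (pd f j) v +
        ENNReal.ofReal ((jap v / 2) ^ (-2 * s) * pd f j v ^ 2)) := by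
      rw [hY]
      beta_reduce
      rw [mul_add, ← ENNReal.ofReal_mul (by positivity), ← ENNReal.ofReal_mul (by positivity)]
      congr 2
      have e1 : jap v ^ (2 * c) = (jap v ^ c) ^ 2 := by rw [mul_comm, rpow_mul hj.le, rpow_two]
      have e2 : (jap v / 2) ^ (-2 * s) = 2 ^ (2 * s) * jap v ^ (-2 * s) := by
        rw [div_rpow hj.le (by norm_num), show -2 * s = -(2 * s) by ring,
          rpow_neg (by norm_num : (0:ℝ) ≤ 2), div_inv_eq_mul, mul_comm]
      rw [e1, e2]; ring
    have ew : jap v ^ (2 * b) = (jap v ^ (2 * a)) ^ s * (jap v ^ (2 * c)) ^ (1 - s) := by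
      rw [← rpow_mul hj.le, ← rpow_mul hj.le, ← rpow_add hj]
      congr 1; rw [habc]; ring
    rw [eY, hX]
    beta_reduce
    rw [ENNReal.mul_rpow_of_nonneg _ _ hs0.le, ENNReal.mul_rpow_of_nonneg _ _ (by linarith),
      ENNReal.ofReal_mul (by positivity), ew, ENNReal.ofReal_mul (by positivity),
      ENNReal.ofReal_rpow_of_nonneg (by positivity) hs0.le,
      ENNReal.ofReal_rpow_of_nonneg (by positivity) (by linarith)]
    calc _ ≤ ENNReal.ofReal ((jap v ^ (2 * a)) ^ s) *
          ENNReal.ofReal ((jap v ^ (2 * c)) ^ (1 - s)) * (ENNReal.ofReal K * (locE s f v ^ s *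
      (locE s (pd f j) v + ENNReal.ofReal ((jap v / 2) ^ (-2 * s) * pd f j v ^ 2)) ^ (1 - s))) := by
          gcongr
      _ = _ := by ring
  have iX : ∫⁻ v, X v ≤ ENNReal.ofReal CA * gagE s (fun v => jap v ^ a * f v) :=
    hA f hf.continuous hc
  set h : E3 → ℝ := fun v => jap v ^ c * pd f j v with hh
  have hhc : Continuous h :=
    (jap_cont.rpow_const (fun v => Or.inl (jap_pos v).ne')).mul hpcont
  have hhs : HasCompactSupport h := hpc.mul_left
  have iY : ∫⁻ v, Y v ≤ ENNReal.ofReal (CC + 2 ^ (2 * s) * CH) * gagE s h := by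
    rw [hY, lintegral_add_left (by fun_prop), lintegral_const_mul' _ _ ENNReal.ofReal_ne_top,
      ENNReal.ofReal_add (by positivity) (by positivity), add_mul,
      ENNReal.ofReal_mul (by positivity), mul_assoc]
    gcongr
    · exact hCo _ hpcont hpc
    · exact hH h hhc hhs
  calc _ ≤ ∫⁻ v, ENNReal.ofReal K * (X v ^ s * Y v ^ (1 - s)) := lintegral_mono_ae hpt
    _ = ENNReal.ofReal K * ∫⁻ v, X v ^ s * Y v ^ (1 - s) :=
        lintegral_const_mul' _ _ ENNReal.ofReal_ne_top
    _ ≤ ENNReal.ofReal K * ((∫⁻ v, X v) ^ s * (∫⁻ v, Y v) ^ (1 - s)) := by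
        gcongr
        exact ENNReal.lintegral_mul_norm_pow_le hXm.aemeasurable hYm.aemeasurable hs0.le
          (by linarith) (by ring)
    _ ≤ ENNReal.ofReal K * ((ENNReal.ofReal CA * gagE s (fun v => jap v ^ a * f v)) ^ s *
        (ENNReal.ofReal (CC + 2 ^ (2 * s) * CH) * gagE s h) ^ (1 - s)) := by
        gcongr
    _ = _ := by
        rw [ENNReal.mul_rpow_of_nonneg _ _ hs0.le, ENNReal.mul_rpow_of_nonneg _ _ (by linarith),
          ENNReal.ofReal_rpow_of_nonneg (by positivity) hs0.le,
          ENNReal.ofReal_rpow_of_nonneg (by positivity) (by linarith),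
          ENNReal.ofReal_mul hK.le, ENNReal.ofReal_mul (by positivity)]
        ring

lemma jap_contDiff (a : ℝ) : ContDiff ℝ 1 (fun v => jap v ^ a) := by
  apply ContDiff.rpow_const_of_ne
  · unfold jap
    apply ContDiff.sqrt
    · exact contDiff_const.add (contDiff_norm_sq ℝ)
    · intro v; positivity
  · intro v; exact (jap_pos v).ne'

lemma gagSq_nonneg (s : ℝ) (g : E3 → ℝ) : 0 ≤ gagSq s g := by
  unfold gagSq
  exact integral_nonneg fun v => integral_nonneg fun w => by positivity

/-- **Velocity-weighted Gagliardo–Nirenberg interpolation inequality** (gradient form).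
For `0 < s < 1`, `max{−3, −3/2 − 2s} < γ < −2s` and `ℓ ≤ 0`, there is a constant
`C = C(s,γ,ℓ) > 0` such that for every `f ∈ C_c^∞(ℝ³;ℝ)`,
`‖⟨v⟩^{ℓ+γ/(2s)} ∇_v f‖_{L²} ≤ C [⟨v⟩^{ℓ+γ/2} f]_{Ḣ^s}^s [⟨v⟩^{ℓ+(1+s)γ/(2s)} ∇_v f]_{Ḣ^s}^{1−s}`,
where the seminorm of the (vector-valued) gradient is the ℓ² sum of those of its components. -/
theorem weighted_gagliardo_nirenberg
    (s γ ℓ : ℝ) (hs0 : 0 < s) (hs1 : s < 1)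
    (hγ1 : max (-3) (-3/2 - 2*s) < γ) (hγ2 : γ < -2*s) (hℓ : ℓ ≤ 0) :
    ∃ C > 0, ∀ f : E3 → ℝ, ContDiff ℝ (⊤ : ℕ∞) f → HasCompactSupport f →
      Real.sqrt (∫ v : E3, (jap v ^ (ℓ + γ/(2*s))) ^ 2 * ∑ j : Fin 3, (pd f j v) ^ 2) ≤
        C * Real.sqrt (gagSq s (fun v => jap v ^ (ℓ + γ/2) * f v)) ^ s *
          Real.sqrt (∑ j : Fin 3,
              gagSq s (fun v => jap v ^ (ℓ + (1+s)*γ/(2*s)) * pd f j v)) ^ (1 - s) := by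
  have habc : ℓ + γ/(2*s) = s * (ℓ + γ/2) + (1 - s) * (ℓ + (1+s)*γ/(2*s)) := by
    field_simp
    ring
  generalize ℓ + γ/(2*s) = b at habc ⊢
  generalize ℓ + γ/2 = a at habc ⊢
  generalize ℓ + (1+s)*γ/(2*s) = c at habc ⊢
  obtain ⟨K, hK, hcomp⟩ := component_bound hs0 hs1 a b c habc
  refine ⟨Real.sqrt (3 * K), by positivity, ?_⟩
  intro f hf hc
  have hf2 : ContDiff ℝ 2 f := (contDiff_infty.mp hf) 2
  have hf1 : ContDiff ℝ 1 f := hf2.of_le (by norm_num)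
  have hp1 : ∀ j, ContDiff ℝ 1 (pd f j) := by
    intro j
    unfold pd
    exact (hf2.fderiv_right (m := 1) (by norm_num)).clm_apply contDiff_const
  have hpc : ∀ j, HasCompactSupport (pd f j) := fun j =>
    (hc.fderiv (𝕜 := ℝ)).comp_left (g := fun A : E3 →L[ℝ] ℝ => A (EuclideanSpace.single j 1))
      (by simp)
  have hA : ENNReal.ofReal (gagSq s (fun v => jap v ^ a * f v)) =
      gagE s (fun v => jap v ^ a * f v) := by
    have h1 : ContDiff ℝ 1 (fun v => jap v ^ a * f v) := (jap_contDiff a).mul hf1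
    exact gagSq_eq h1.continuous (gagE_fin hs0 hs1 h1 hc.mul_left)
  have hB : ∀ j, ENNReal.ofReal (gagSq s (fun v => jap v ^ c * pd f j v)) =
      gagE s (fun v => jap v ^ c * pd f j v) := by
    intro j
    have h1 : ContDiff ℝ 1 (fun v => jap v ^ c * pd f j v) := (jap_contDiff c).mul (hp1 j)
    exact gagSq_eq h1.continuous (gagE_fin hs0 hs1 h1 (hpc j).mul_left)
  have hA0 := gagSq_nonneg s (fun v => jap v ^ a * f v)
  have hB0 : ∀ j, 0 ≤ gagSq s (fun v => jap v ^ c * pd f j v) := fun j => gagSq_nonneg s _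
  have hcj : ∀ j, ∫ v, jap v ^ (2 * b) * pd f j v ^ 2 ≤
      K * (gagSq s (fun v => jap v ^ a * f v) ^ s *
        gagSq s (fun v => jap v ^ c * pd f j v) ^ (1 - s)) := by
    intro j
    have h := hcomp f hf2 hc j
    rw [← hA, ← hB, ENNReal.ofReal_rpow_of_nonneg hA0 hs0.le,
      ENNReal.ofReal_rpow_of_nonneg (hB0 j) (by linarith),
      ← ENNReal.ofReal_mul (rpow_nonneg hA0 _), ← ENNReal.ofReal_mul hK.le] at h
    rw [integral_eq_lintegral_of_nonneg_ae]
    · refine ENNReal.toReal_le_of_le_ofReal ?_ h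
      have := hB0 j
      positivity
    · exact Filter.Eventually.of_forall fun v => by have := jap_pos v; positivity
    · exact ((jap_contDiff (2 * b)).continuous.mul
        ((hp1 j).continuous.pow 2)).aestronglyMeasurable
  have hintg : ∀ j, Integrable (fun v => jap v ^ (2 * b) * pd f j v ^ 2) := by
    intro j
    refine Continuous.integrable_of_hasCompactSupport
      ((jap_contDiff (2 * b)).continuous.mul ((hp1 j).continuous.pow 2)) ?_
    have : HasCompactSupport (fun v => pd f j v ^ 2) :=
      (hpc j).comp_left (g := fun x : ℝ => x ^ 2) (by simp)
    exact this.mul_left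
  generalize gagSq s (fun v => jap v ^ a * f v) = A at *
  set B : Fin 3 → ℝ := fun j => gagSq s (fun v => jap v ^ c * pd f j v) with hBdef
  have hS0 : 0 ≤ ∑ j, B j := Finset.sum_nonneg fun j _ => hB0 j
  have hI : ∫ v : E3, (jap v ^ b) ^ 2 * ∑ j : Fin 3, (pd f j v) ^ 2 ≤
      3 * K * A ^ s * (∑ j, B j) ^ (1 - s) := by
    have e : ∀ v : E3, (jap v ^ b) ^ 2 * ∑ j : Fin 3, (pd f j v) ^ 2 =
        ∑ j : Fin 3, jap v ^ (2 * b) * pd f j v ^ 2 := by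
      intro v
      rw [Finset.mul_sum, mul_comm 2 b, rpow_mul (jap_pos v).le, rpow_two]
    simp_rw [e]
    rw [integral_finsetSum _ fun j _ => hintg j]
    calc _ ≤ ∑ j : Fin 3, K * (A ^ s * (∑ j, B j) ^ (1 - s)) := by
          refine Finset.sum_le_sum fun j _ => (hcj j).trans ?_
          have h1 : B j ≤ ∑ j, B j :=
            Finset.single_le_sum (fun i _ => hB0 i) (Finset.mem_univ j)
          have h2 : B j ^ (1 - s) ≤ (∑ j, B j) ^ (1 - s) :=
            rpow_le_rpow (hB0 j) h1 (by linarith)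
          have h3 : 0 ≤ A ^ s := rpow_nonneg hA0 _
          exact mul_le_mul_of_nonneg_left (mul_le_mul_of_nonneg_left h2 h3) hK.le
      _ = _ := by
          rw [Finset.sum_const, Finset.card_univ, Fintype.card_fin, nsmul_eq_mul]
          push_cast
          ring
  have sq : ∀ x t : ℝ, 0 ≤ x → Real.sqrt (x ^ t) = Real.sqrt x ^ t := by
    intro x t hx
    rw [sqrt_eq_rpow, sqrt_eq_rpow, ← rpow_mul hx, ← rpow_mul hx, mul_comm]
  calc _ ≤ Real.sqrt (3 * K * A ^ s * (∑ j, B j) ^ (1 - s)) := sqrt_le_sqrt hI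
    _ = _ := by
      rw [sqrt_mul (by positivity), sqrt_mul (by positivity), sq _ _ hA0, sq _ _ hS0]
end
end

section
/- (Weighted Volterra estimate for the density.) Let M ≥ 1 be an integer and C₀ > 0. There exists a constant C = C(C₀, M) > 0 with the following property. Let k ∈ ℤ³ \ {0}, t > 0, let ρ, N : [0,t] → ℂ be continuous, and let G : [0,t] → ℂ be measurable with |G(τ)| ≤ C₀ |k|^{−1} ⟨kτ⟩^{−2M−2} for all τ ∈ [0,t]. Suppose ρ(τ) = N(τ) + ∫₀^τ G(τ−σ) N(σ) dσ for all τ ∈ [0,t]. Then for all nonnegative integers a, w with a + w ≤ M, |k|^{2a} ⟨kt⟩^{2w} |ρ(t)|² ≤ C ( |k|^{2a} ⟨kt⟩^{2w} |N(t)|² + ∫₀^t |k|^{2a−3} ⟨k(t−σ)⟩^{−2} ⟨kσ⟩^{2w} |N(σ)|² dσ ). -/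
open MeasureTheory Real

noncomputable section

/-- Euclidean norm of an integer vector `k ∈ ℤ³`. -/
def normZ (k : Fin 3 → ℤ) : ℝ := Real.sqrt (∑ j, ((k j : ℝ)) ^ 2)

/-- Japanese bracket of a real number, `⟨r⟩ = √(1 + r²)`; note that for `k ∈ ℤ³`
and `τ ∈ ℝ` one has `⟨kτ⟩ = √(1 + τ²|k|²) = br (|k| τ)`. -/
def br (r : ℝ) : ℝ := Real.sqrt (1 + r ^ 2)

lemma br_sq (x : ℝ) : br x ^ 2 = 1 + x ^ 2 := by
  unfold br
  rw [Real.sq_sqrt (by positivity)]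

lemma br_pos (x : ℝ) : 0 < br x := by
  unfold br
  positivity

lemma br_pow (x : ℝ) (w : ℕ) : br x ^ (2*w) = (1 + x ^ 2) ^ w := by
  rw [pow_mul, br_sq]

lemma br_neg (x : ℝ) (m : ℕ) : br x ^ (-(2*(m:ℝ) + 2)) = ((1 + x ^ 2) ^ (m+1))⁻¹ := by
  rw [Real.rpow_neg (br_pos x).le, ← br_pow, ← Real.rpow_natCast]
  congr 2
  push_cast
  ring

lemma br_neg_two (x : ℝ) : br x ^ (-(2:ℝ)) = (1 + x ^ 2)⁻¹ := by
  have := br_neg x 0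
  simpa using this

lemma one_le_normZ (k : Fin 3 → ℤ) (hk : k ≠ 0) : 1 ≤ normZ k := by
  obtain ⟨i, hi⟩ := Function.ne_iff.mp hk
  unfold normZ
  rw [Real.one_le_sqrt]
  have h1 : (1:ℝ) ≤ (k i : ℝ) ^ 2 := by
    have h0 : k i ≠ 0 := hi
    have : 0 < (k i) ^ 2 := by positivity
    exact_mod_cast this
  refine h1.trans ?_
  exact Finset.single_le_sum (f := fun j => ((k j : ℝ)) ^ 2)
    (fun j _ => sq_nonneg _) (Finset.mem_univ i)

lemma int_bound (K t : ℝ) (hK : 0 < K) :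
    ∫ σ in (0:ℝ)..t, (1 + (K * (t - σ)) ^ 2)⁻¹ ≤ π / (2 * K) := by
  have hd : ∀ σ ∈ Set.uIcc 0 t, HasDerivAt (fun σ => - Real.arctan (K * (t - σ)) / K)
      ((1 + (K * (t - σ)) ^ 2)⁻¹) σ := by
    intro σ _
    have h1 : HasDerivAt (fun σ => K * (t - σ)) (K * (-1)) σ :=
      ((hasDerivAt_id σ).const_sub t).const_mul K
    have h2 := (h1.arctan.neg).div_const K
    have e : -(1 / (1 + (K * (t - σ)) ^ 2) * (K * (-1))) / K = (1 + (K * (t - σ)) ^ 2)⁻¹ := by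
      have : 0 < 1 + (K * (t - σ)) ^ 2 := by positivity
      field_simp
    rw [← e]
    exact h2
  rw [intervalIntegral.integral_eq_sub_of_hasDerivAt hd]
  · have := (Real.arctan_lt_pi_div_two (K * t)).le
    simp only [sub_self, mul_zero, Real.arctan_zero, neg_zero, zero_div, sub_zero, zero_sub]
    rw [neg_div, neg_neg, div_le_div_iff₀ hK (by positivity)]
    nlinarith
  · apply Continuous.intervalIntegrable
    refine Continuous.inv₀ (by fun_prop) (fun x => by positivity)

lemma peetre (x y : ℝ) (w M : ℕ) (h : w ≤ M) :
    (1 + (x + y) ^ 2) ^ w * ((1 + x ^ 2) ^ (M+1))⁻¹ ≤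
      2 ^ M * ((1 + x ^ 2)⁻¹ * (1 + y ^ 2) ^ w) := by
  have h1 : (1 + (x + y) ^ 2) ^ w ≤ 2 ^ M * ((1 + x ^ 2) ^ M * (1 + y ^ 2) ^ w) := by
    calc (1 + (x + y) ^ 2) ^ w ≤ (2 * ((1 + x ^ 2) * (1 + y ^ 2))) ^ w := by
          apply pow_le_pow_left₀ (by positivity)
          nlinarith [sq_nonneg (x - y), sq_nonneg (x * y)]
      _ = 2 ^ w * ((1 + x ^ 2) ^ w * (1 + y ^ 2) ^ w) := by rw [mul_pow, mul_pow]
      _ ≤ _ := by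
          gcongr
          · norm_num
          · nlinarith [sq_nonneg x]
  have hx : 0 < 1 + x ^ 2 := by positivity
  calc _ ≤ 2 ^ M * ((1 + x ^ 2) ^ M * (1 + y ^ 2) ^ w) * ((1 + x ^ 2) ^ (M+1))⁻¹ := by gcongr
    _ = _ := by
      rw [pow_succ]
      field_simp
      ring

/-- Cauchy-Schwarz with weight. -/
lemma cs (t A : ℝ) (ht : 0 < t) (hA : 0 < A) (g n : ℝ → ℝ) (hg : ∀ x, 0 ≤ g x)
    (hgc : Continuous g) (hn : ContinuousOn n (Set.Icc 0 t))
    (hgA : ∫ σ in (0:ℝ)..t, g σ ≤ A) :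
    (∫ σ in (0:ℝ)..t, g σ * n σ) ^ 2 ≤ A * ∫ σ in (0:ℝ)..t, g σ * n σ ^ 2 := by
  have hgo : ContinuousOn g (Set.Icc 0 t) := hgc.continuousOn
  set B := ∫ σ in (0:ℝ)..t, g σ * n σ with hB
  set D := ∫ σ in (0:ℝ)..t, g σ * n σ ^ 2 with hD
  have i1 : IntervalIntegrable g volume 0 t := hgc.intervalIntegrable _ _
  have i2 : IntervalIntegrable (fun σ => g σ * n σ) volume 0 t :=
    (hgo.mul hn).intervalIntegrable_of_Icc ht.le
  have i3 : IntervalIntegrable (fun σ => g σ * n σ ^ 2) volume 0 t :=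
    (hgo.mul (hn.pow 2)).intervalIntegrable_of_Icc ht.le
  have h0 : 0 ≤ ∫ σ in (0:ℝ)..t, g σ * (A * n σ - B) ^ 2 :=
    intervalIntegral.integral_nonneg ht.le (fun u _ => mul_nonneg (hg u) (sq_nonneg _))
  have h1 : ∫ σ in (0:ℝ)..t, g σ * (A * n σ - B) ^ 2 =
      A ^ 2 * D - 2 * A * B * B + B ^ 2 * ∫ σ in (0:ℝ)..t, g σ := by
    have e : (fun σ => g σ * (A * n σ - B) ^ 2) = fun σ =>
        A ^ 2 * (g σ * n σ ^ 2) - 2 * A * B * (g σ * n σ) + B ^ 2 * g σ := by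
      funext σ; ring
    rw [e, intervalIntegral.integral_add ((i3.const_mul _).sub (i2.const_mul _))
      (i1.const_mul _), intervalIntegral.integral_sub (i3.const_mul _) (i2.const_mul _)]
    simp only [intervalIntegral.integral_const_mul, ← hB, ← hD]
  rw [h1] at h0
  have h2 : B ^ 2 * ∫ σ in (0:ℝ)..t, g σ ≤ B ^ 2 * A :=
    mul_le_mul_of_nonneg_left hgA (sq_nonneg _)
  have h3 : 0 ≤ A * (A * D - B ^ 2) := by nlinarith
  have := nonneg_of_mul_nonneg_right h3 hA
  linarith

/-- **Weighted Volterra estimate for the density.**  Let `M ≥ 1` and `C₀ > 0`.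
There is `C = C(C₀, M) > 0` such that whenever `k ∈ ℤ³ \ {0}`, `t > 0`,
`ρ, N : [0,t] → ℂ` are continuous, `G` is measurable with
`|G(τ)| ≤ C₀ |k|⁻¹ ⟨kτ⟩^{−2M−2}` on `[0,t]`, and
`ρ(τ) = N(τ) + ∫₀^τ G(τ−σ) N(σ) dσ` for `τ ∈ [0,t]`, then for all `a + w ≤ M`,
`|k|^{2a} ⟨kt⟩^{2w} |ρ(t)|² ≤ C (|k|^{2a} ⟨kt⟩^{2w} |N(t)|²
  + ∫₀^t |k|^{2a−3} ⟨k(t−σ)⟩^{−2} ⟨kσ⟩^{2w} |N(σ)|² dσ)`. -/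
theorem weighted_volterra_density (M : ℕ) (hM : 1 ≤ M) (C₀ : ℝ) (hC₀ : 0 < C₀) :
    ∃ C > 0, ∀ k : Fin 3 → ℤ, k ≠ 0 → ∀ t : ℝ, 0 < t →
      ∀ (ρ N : ℝ → ℂ) (G : ℝ → ℂ),
      ContinuousOn ρ (Set.Icc 0 t) → ContinuousOn N (Set.Icc 0 t) → Measurable G →
      (∀ τ ∈ Set.Icc (0:ℝ) t,
        ‖G τ‖ ≤ C₀ * (normZ k)⁻¹ * br (normZ k * τ) ^ (-(2*(M:ℝ) + 2))) →
      (∀ τ ∈ Set.Icc (0:ℝ) t, ρ τ = N τ + ∫ σ in (0:ℝ)..τ, G (τ - σ) * N σ) →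
      ∀ a w : ℕ, a + w ≤ M →
        normZ k ^ (2*a) * br (normZ k * t) ^ (2*w) * ‖ρ t‖ ^ 2 ≤
          C * (normZ k ^ (2*a) * br (normZ k * t) ^ (2*w) * ‖N t‖ ^ 2 +
            ∫ σ in (0:ℝ)..t,
              normZ k ^ (2*(a:ℝ) - 3) * br (normZ k * (t - σ)) ^ (-(2:ℝ)) *
                br (normZ k * σ) ^ (2*w) * ‖N σ‖ ^ 2) := by
  refine ⟨2 + 2 ^ M * C₀ ^ 2 * π, by positivity, ?_⟩
  intro k hk t ht ρ N G _ hN _ hG hρ a w haw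
  have hK1 := one_le_normZ k hk
  set K := normZ k with hKdef
  have hK : 0 < K := by linarith
  set g : ℝ → ℝ := fun σ => ((1 + (K * (t - σ)) ^ 2) ^ (M+1))⁻¹ with hgdef
  have hg0 : ∀ x, 0 ≤ g x := fun x => by simp only [hgdef]; positivity
  have hgc : Continuous g := Continuous.inv₀ (by fun_prop) (fun x => by positivity)
  have hq : Continuous (fun σ : ℝ => (1 + (K * (t - σ)) ^ 2)⁻¹) :=
    Continuous.inv₀ (by fun_prop) (fun x => by positivity)
  have hn : ContinuousOn (fun σ => ‖N σ‖) (Set.Icc 0 t) := hN.norm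
  have hgA : ∫ σ in (0:ℝ)..t, g σ ≤ π / (2 * K) := by
    refine le_trans ?_ (int_bound K t hK)
    refine intervalIntegral.integral_mono_on ht.le (hgc.intervalIntegrable _ _)
      (hq.intervalIntegrable _ _) ?_
    intro σ _
    simp only [hgdef]
    apply inv_anti₀ (by positivity)
    exact le_self_pow₀ (by nlinarith [sq_nonneg (K * (t - σ))]) (by omega)
  have hcs := cs t (π / (2 * K)) ht (by positivity) g (fun σ => ‖N σ‖) hg0 hgc hn hgA
  set D := ∫ σ in (0:ℝ)..t, g σ * ‖N σ‖ ^ 2 with hD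
  set B := ∫ σ in (0:ℝ)..t, g σ * ‖N σ‖ with hB
  have hI : ‖∫ σ in (0:ℝ)..t, G (t - σ) * N σ‖ ≤ C₀ * K⁻¹ * B := by
    rw [hB, ← intervalIntegral.integral_const_mul]
    apply intervalIntegral.norm_integral_le_of_norm_le ht.le
    · refine Filter.Eventually.of_forall (fun σ hσ => ?_)
      have := hG (t - σ) ⟨by linarith [hσ.2], by linarith [hσ.1]⟩
      rw [br_neg] at this
      rw [norm_mul, ← mul_assoc]
      exact mul_le_mul_of_nonneg_right this (norm_nonneg _)
    · exact ((hgc.continuousOn.mul hn).intervalIntegrable_of_Icc ht.le).const_mul _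
  set E := ∫ σ in (0:ℝ)..t, (1 + (K * (t - σ)) ^ 2)⁻¹ *
    (1 + (K * σ) ^ 2) ^ w * ‖N σ‖ ^ 2 with hE
  have hE0 : 0 ≤ E := intervalIntegral.integral_nonneg ht.le (fun u _ => by positivity)
  have hDE : (1 + (K * t) ^ 2) ^ w * D ≤ 2 ^ M * E := by
    rw [hD, hE, ← intervalIntegral.integral_const_mul, ← intervalIntegral.integral_const_mul]
    refine intervalIntegral.integral_mono_on ht.le
      (((hgc.continuousOn.mul (hn.pow 2)).intervalIntegrable_of_Icc ht.le).const_mul _)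
      ((((hq.mul (by fun_prop)).continuousOn.mul
        (hn.pow 2)).intervalIntegrable_of_Icc ht.le).const_mul _) ?_
    intro σ _
    have := peetre (K * (t - σ)) (K * σ) w M (by omega)
    rw [show K * (t - σ) + K * σ = K * t by ring] at this
    have := mul_le_mul_of_nonneg_right this (sq_nonneg ‖N σ‖)
    simp only [hgdef]
    linarith
  have hKp : K ^ (2*(a:ℝ) - 3) = K ^ (2*a) * (K ^ 3)⁻¹ := by
    rw [Real.rpow_sub hK, div_eq_mul_inv, ← Real.rpow_natCast, ← Real.rpow_natCast]
    push_cast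
    rfl
  have hint : (∫ σ in (0:ℝ)..t, K ^ (2*(a:ℝ) - 3) * br (K * (t - σ)) ^ (-(2:ℝ)) *
      br (K * σ) ^ (2*w) * ‖N σ‖ ^ 2) = K ^ (2*a) * (K ^ 3)⁻¹ * E := by
    rw [hE, ← intervalIntegral.integral_const_mul]
    congr 1
    funext σ
    rw [hKp, br_neg_two, br_pow]
    ring
  rw [hint, br_pow]
  have hρt : ‖ρ t‖ ≤ ‖N t‖ + C₀ * K⁻¹ * B := by
    rw [hρ t ⟨ht.le, le_refl _⟩]
    exact (norm_add_le _ _).trans (by linarith)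
  have hsq : ‖ρ t‖ ^ 2 ≤ 2 * ‖N t‖ ^ 2 + 2 * (C₀ * K⁻¹) ^ 2 * (π / (2 * K) * D) := by
    have h1 : ‖ρ t‖ ^ 2 ≤ (‖N t‖ + C₀ * K⁻¹ * B) ^ 2 := by gcongr
    have h2 : 2 * (C₀ * K⁻¹) ^ 2 * B ^ 2 ≤ 2 * (C₀ * K⁻¹) ^ 2 * (π / (2 * K) * D) := by
      gcongr
    nlinarith [sq_nonneg (‖N t‖ - C₀ * K⁻¹ * B)]
  set W := (1 + (K * t) ^ 2) ^ w with hW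
  have hW0 : 0 ≤ W := by positivity
  set P := K ^ (2*a) with hP
  have hP0 : 0 ≤ P := by positivity
  calc P * W * ‖ρ t‖ ^ 2
      ≤ P * W * (2 * ‖N t‖ ^ 2 + 2 * (C₀ * K⁻¹) ^ 2 * (π / (2 * K) * D)) := by gcongr
    _ = 2 * (P * W * ‖N t‖ ^ 2) + C₀ ^ 2 * π * (P * (K ^ 3)⁻¹) * (W * D) := by
        field_simp
    _ ≤ 2 * (P * W * ‖N t‖ ^ 2) + C₀ ^ 2 * π * (P * (K ^ 3)⁻¹) * (2 ^ M * E) := by gcongr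
    _ ≤ _ := by
        have e1 : 0 ≤ 2 ^ M * C₀ ^ 2 * π * (P * W * ‖N t‖ ^ 2) := by positivity
        have e2 : 0 ≤ P * (K ^ 3)⁻¹ * E := by positivity
        linarith
end
end

section
/- (Stretched-exponential weighted convolution estimate.) Let a ∈ (0,1), δ₀ > 0, 0 < δ ≤ δ₀/2, and λ > 0. There exists a constant C = C(a, δ₀) > 0 such that for every measurable F : [0,∞) → [0,∞) and every τ ≥ 0, e^{δ (λτ)^a} ( ∫₀^τ e^{−δ₀ (λ(τ−σ))^a} F(σ) dσ )² ≤ C λ^{−1} ∫₀^τ e^{−(δ₀/2)(λ(τ−σ))^a} e^{δ (λσ)^a} F(σ)² dσ. (The proof combines the subadditivity (λτ)^a ≤ (λσ)^a + (λ(τ−σ))^a for 0 ≤ σ ≤ τ, the Cauchy–Schwarz inequality, and the bound ∫₀^∞ e^{−δ₀(λu)^a} du ≤ C(a,δ₀) λ^{−1}.) -/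
open MeasureTheory Real ENNReal

noncomputable section

theorem kernel_bound (a : ℝ) (ha0 : 0 < a) (δ₀ : ℝ) (hδ₀ : 0 < δ₀) (l : ℝ) (hl : 0 < l) (τ : ℝ) :
    ∫⁻ σ in Set.Ioc (0:ℝ) τ, ENNReal.ofReal (Real.exp (-(δ₀ * (l * (τ - σ)) ^ a))) ≤
      ENNReal.ofReal (δ₀ ^ (-1 / a) * Real.Gamma (1 / a + 1) / l) := by
  set g : ℝ → ℝ≥0∞ := fun u => ENNReal.ofReal (Real.exp (-(δ₀ * (l * u) ^ a))) with hg
  have hb : 0 < δ₀ * l ^ a := by positivity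
  have hint := integral_exp_neg_mul_rpow ha0 hb
  have hpos : 0 < (δ₀ * l ^ a) ^ (-1 / a) * Real.Gamma (1 / a + 1) :=
    mul_pos (by positivity) (Real.Gamma_pos_of_pos (by positivity))
  have hI : IntegrableOn (fun x : ℝ => Real.exp (-(δ₀ * l ^ a) * x ^ a)) (Set.Ioi 0) := by
    by_contra h
    have := integral_undef h
    rw [hint] at this
    exact hpos.ne' this
  have e1 : (δ₀ * l ^ a) ^ (-1 / a) = δ₀ ^ (-1 / a) / l := by
    rw [Real.mul_rpow hδ₀.le (by positivity), ← Real.rpow_mul hl.le]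
    have : a * (-1 / a) = -1 := by field_simp
    rw [this, Real.rpow_neg_one]; rfl
  have e2 : ∫⁻ u in Set.Ici (0:ℝ), g u
      = ENNReal.ofReal (δ₀ ^ (-1 / a) * Real.Gamma (1 / a + 1) / l) := by
    rw [setLIntegral_congr (Ioi_ae_eq_Ici (a := (0:ℝ)) (μ := volume)).symm]
    have : δ₀ ^ (-1 / a) * Real.Gamma (1 / a + 1) / l
        = (δ₀ * l ^ a) ^ (-1 / a) * Real.Gamma (1 / a + 1) := by rw [e1]; ring
    rw [this, ← hint, ofReal_integral_eq_lintegral_ofReal hI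
      (Filter.Eventually.of_forall fun x => (Real.exp_pos _).le)]
    refine setLIntegral_congr_fun measurableSet_Ioi fun x hx => ?_
    have hx' : (0:ℝ) < x := hx
    simp only [hg]
    rw [Real.mul_rpow hl.le hx'.le]
    ring_nf
  rw [← e2, ← lintegral_indicator measurableSet_Ioc, ← lintegral_indicator measurableSet_Ici,
    ← lintegral_sub_left_eq_self ((Set.Ici (0:ℝ)).indicator g) τ]
  refine lintegral_mono fun σ => ?_
  by_cases h : σ ∈ Set.Ioc 0 τ
  · have h2 : τ - σ ∈ Set.Ici (0:ℝ) := by simpa using h.2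
    simp only [Set.indicator_of_mem h, Set.indicator_of_mem h2, hg, le_refl]
  · simp [Set.indicator_of_notMem h]

theorem cauchy_schwarz_weight {μ : Measure ℝ} (w f : ℝ → ℝ≥0∞) (hw : Measurable w)
    (hf : Measurable f) :
    (∫⁻ x, w x ^ 2 * f x ∂μ) ^ 2 ≤ (∫⁻ x, w x ^ 2 ∂μ) * ∫⁻ x, w x ^ 2 * f x ^ 2 ∂μ := by
  have h := ENNReal.lintegral_mul_le_Lp_mul_Lq μ Real.HolderConjugate.two_two
    hw.aemeasurable (hw.mul hf).aemeasurable
  have h2 := pow_le_pow_left' h 2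
  have e : ∀ x : ℝ≥0∞, (x ^ (1 / (2:ℝ))) ^ 2 = x := fun x => by
    rw [← ENNReal.rpow_natCast, ← ENNReal.rpow_mul]; norm_num
  rw [mul_pow, e, e] at h2
  have e1 : ∀ x, w x ^ 2 * f x = (w * (w * f)) x := fun x => by
    simp only [Pi.mul_apply]; ring
  have e2 : ∀ x, w x ^ 2 * f x ^ 2 = (w * f) x ^ (2:ℝ) := fun x => by
    simp only [Pi.mul_apply, ENNReal.rpow_two, mul_pow]
  have e3 : ∀ x, w x ^ 2 = w x ^ (2:ℝ) := fun x => (ENNReal.rpow_two _).symm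
  rw [lintegral_congr e1, lintegral_congr e2, lintegral_congr e3]
  exact h2

/-- **Stretched-exponential weighted convolution estimate.**  Let `a ∈ (0,1)` and
`δ₀ > 0`.  There is `C = C(a, δ₀) > 0` such that for every `0 < δ ≤ δ₀/2`, `λ > 0`,
every measurable `F : [0,∞) → [0,∞)` and every `τ ≥ 0`,
`e^{δ(λτ)^a} (∫₀^τ e^{−δ₀(λ(τ−σ))^a} F(σ) dσ)²
  ≤ C λ⁻¹ ∫₀^τ e^{−(δ₀/2)(λ(τ−σ))^a} e^{δ(λσ)^a} F(σ)² dσ`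
(stated with lower Lebesgue integrals so that both sides are meaningful even when
the integrals are infinite). -/
theorem stretched_exponential_convolution
    (a : ℝ) (ha0 : 0 < a) (ha1 : a < 1) (δ₀ : ℝ) (hδ₀ : 0 < δ₀) :
    ∃ C > 0, ∀ δ : ℝ, 0 < δ → δ ≤ δ₀ / 2 → ∀ l : ℝ, 0 < l →
      ∀ F : ℝ → ℝ, Measurable F → (∀ σ, 0 ≤ F σ) →
      ∀ τ : ℝ, 0 ≤ τ →
        ENNReal.ofReal (Real.exp (δ * (l * τ) ^ a)) *
            (∫⁻ σ in Set.Ioc (0:ℝ) τ,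
              ENNReal.ofReal (Real.exp (-(δ₀ * (l * (τ - σ)) ^ a)) * F σ)) ^ 2 ≤
          ENNReal.ofReal (C / l) *
            ∫⁻ σ in Set.Ioc (0:ℝ) τ,
              ENNReal.ofReal (Real.exp (-(δ₀ / 2 * (l * (τ - σ)) ^ a)) *
                Real.exp (δ * (l * σ) ^ a) * (F σ) ^ 2) := by
  refine ⟨δ₀ ^ (-1 / a) * Real.Gamma (1 / a + 1),
    mul_pos (by positivity) (Real.Gamma_pos_of_pos (by positivity)), ?_⟩
  intro δ hδ hδ' l hl F hF hF0 τ hτ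
  set w : ℝ → ℝ≥0∞ := fun σ => ENNReal.ofReal (Real.exp (-(δ₀ / 2 * (l * (τ - σ)) ^ a))) with hw
  have hwm : Measurable w := by fun_prop
  have hfm : Measurable fun σ => ENNReal.ofReal (F σ) := by fun_prop
  have hw2 : ∀ σ, w σ ^ 2 = ENNReal.ofReal (Real.exp (-(δ₀ * (l * (τ - σ)) ^ a))) := by
    intro σ
    simp only [hw]
    rw [← ENNReal.ofReal_pow (Real.exp_pos _).le, ← Real.exp_nat_mul]
    congr 2; push_cast; ring
  have hcs := cauchy_schwarz_weight (μ := volume.restrict (Set.Ioc 0 τ)) w _ hwm hfm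
  have hk := kernel_bound a ha0 δ₀ hδ₀ l hl τ
  simp only [hw2] at hcs
  have hL : ∫⁻ σ in Set.Ioc (0:ℝ) τ,
      ENNReal.ofReal (Real.exp (-(δ₀ * (l * (τ - σ)) ^ a)) * F σ)
      = ∫⁻ σ in Set.Ioc (0:ℝ) τ,
      ENNReal.ofReal (Real.exp (-(δ₀ * (l * (τ - σ)) ^ a))) * ENNReal.ofReal (F σ) :=
    lintegral_congr fun σ => ENNReal.ofReal_mul (Real.exp_pos _).le
  rw [hL]
  refine (mul_le_mul_right (hcs.trans (mul_le_mul_left hk _)) _).trans ?_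
  rw [mul_left_comm]
  refine mul_le_mul_right ?_ _
  rw [← lintegral_const_mul' _ _ ENNReal.ofReal_ne_top]
  refine setLIntegral_mono' measurableSet_Ioc fun σ hσ => ?_
  rw [← ENNReal.ofReal_pow (hF0 σ), ← ENNReal.ofReal_mul (Real.exp_pos _).le,
    ← ENNReal.ofReal_mul (Real.exp_pos _).le, ← mul_assoc, ← Real.exp_add, ← Real.exp_add]
  refine ENNReal.ofReal_le_ofReal (mul_le_mul_of_nonneg_right (Real.exp_le_exp.2 ?_) (sq_nonneg _))
  have h1 : 0 ≤ l * σ := mul_nonneg hl.le hσ.1.le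
  have h2 : 0 ≤ l * (τ - σ) := mul_nonneg hl.le (sub_nonneg.2 hσ.2)
  have h3 := Real.rpow_add_le_add_rpow h1 h2 ha0.le ha1.le
  have h4 : l * σ + l * (τ - σ) = l * τ := by ring
  rw [h4] at h3
  have h5 : 0 ≤ (l * (τ - σ)) ^ a := Real.rpow_nonneg h2 a
  nlinarith [mul_le_mul_of_nonneg_left h3 hδ.le, mul_le_mul_of_nonneg_right hδ' h5]
end
end
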